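/- arXiv:1502.04332 — 2 statements merged into one kernel-verified Lean document; each statement's English description precedes it below -/
import Mathlib

section
/- Let n ≥ 4 be an integer and p a prime. The number of ordered pairs (C, C') with C, C' ∈ R^(n)(p) = R₀^(n)(p) ∪ R₁^(n)(p) such that the product C·C' belongs to the right coset Λ_n·diag(p, p², …, p², p³) (with n−2 middle entries equal to p²) equals (2·p^n − p² − 2p + 1)/(p−1). -/
open Matrix

/-- `Λ_n = GL_n(ℤ)` viewed inside the `n × n` rational matrices: the matrices with integer
entries whose determinant is `±1`. -/
def Lambda (n : ℕ) : Set (Matrix (Fin n) (Fin n) ℚ) :=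
  {γ | (∀ i j, ∃ z : ℤ, γ i j = (z : ℚ)) ∧ (γ.det = 1 ∨ γ.det = -1)}

/-- The right coset `Λ_n h = {γ * h : γ ∈ Λ_n}`. -/
def rightCoset (n : ℕ) (h : Matrix (Fin n) (Fin n) ℚ) : Set (Matrix (Fin n) (Fin n) ℚ) :=
  {m | ∃ γ ∈ Lambda n, m = γ * h}

/-- The double coset `Λ_n g Λ_n = {γ₁ * g * γ₂ : γ₁, γ₂ ∈ Λ_n}`. -/
def doubleCoset (n : ℕ) (g : Matrix (Fin n) (Fin n) ℚ) : Set (Matrix (Fin n) (Fin n) ℚ) :=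
  {m | ∃ γ₁ ∈ Lambda n, ∃ γ₂ ∈ Lambda n, m = γ₁ * g * γ₂}

/-- The degree of `g`: the number of distinct right cosets `Λ_n h` contained in `Λ_n g Λ_n`. -/
noncomputable def degree (n : ℕ) (g : Matrix (Fin n) (Fin n) ℚ) : ℕ :=
  Set.ncard {S : Set (Matrix (Fin n) (Fin n) ℚ) | ∃ h ∈ doubleCoset n g, S = rightCoset n h}

/-- The `k`-th determinantal divisor of an `n × n` integer matrix: the gcd of all of its
`k × k` minors (which is `0` when all these minors vanish), a minor being indexed by a pair
of strictly increasing maps `Fin k → Fin n` selecting rows and columns. -/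
def detDiv (n k : ℕ) (C : Matrix (Fin n) (Fin n) ℤ) : ℤ :=
  Finset.gcd ((Finset.univ : Finset ((Fin k → Fin n) × (Fin k → Fin n))).filter
      (fun fg => (∀ a b : Fin k, a < b → fg.1 a < fg.1 b) ∧
        (∀ a b : Fin k, a < b → fg.2 a < fg.2 b)))
    (fun fg => (C.submatrix fg.1 fg.2).det)

/-- `D^(n)(p) = diag(1, p, …, p, p²)` with `n - 2` middle diagonal entries equal to `p`. -/
def Dmat (n p : ℕ) : Matrix (Fin n) (Fin n) ℤ :=
  Matrix.diagonal (fun i => if i.val = 0 then 1 else if i.val = n - 1 then (p : ℤ) ^ 2 else (p : ℤ))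

/-- The set `R₀^(n)(p)` of upper-triangular integer matrices whose determinantal divisors are
`d_k = p^(k-1)` for `1 ≤ k ≤ n - 1` and `d_n = p^n`, whose diagonal entries all equal `p`, and
whose above-diagonal entries lie in `[0, p)`. -/
def R0 (n p : ℕ) : Set (Matrix (Fin n) (Fin n) ℤ) :=
  {C | (∀ i j : Fin n, j < i → C i j = 0) ∧
    (∀ k : ℕ, 1 ≤ k → k ≤ n - 1 → detDiv n k C = (p : ℤ) ^ (k - 1)) ∧
    detDiv n n C = (p : ℤ) ^ n ∧
    (∀ i : Fin n, C i i = (p : ℤ)) ∧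
    (∀ i j : Fin n, i < j → 0 ≤ C i j ∧ C i j < (p : ℤ))}

/-- The set `R₁^(n)(p)` of upper-triangular integer matrices whose diagonal entries lie in
`{1, p, p²}` with exactly one entry `1` and exactly one entry `p²`, whose above-diagonal
entries satisfy `0 ≤ c i j < c j j`, and such that `p ∣ c i i` implies `p ∣ c i j` for `j > i`. -/
def R1 (n p : ℕ) : Set (Matrix (Fin n) (Fin n) ℤ) :=
  {C | (∀ i j : Fin n, j < i → C i j = 0) ∧
    (∀ i : Fin n, C i i = 1 ∨ C i i = (p : ℤ) ∨ C i i = (p : ℤ) ^ 2) ∧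
    (∃! i : Fin n, C i i = 1) ∧
    (∃! i : Fin n, C i i = (p : ℤ) ^ 2) ∧
    (∀ i j : Fin n, i < j → 0 ≤ C i j ∧ C i j < C j j) ∧
    (∀ i j : Fin n, i < j → (p : ℤ) ∣ C i i → (p : ℤ) ∣ C i j)}

/-- Casting an integer matrix to a rational matrix. -/
def toQ (n : ℕ) (C : Matrix (Fin n) (Fin n) ℤ) : Matrix (Fin n) (Fin n) ℚ :=
  C.map (fun z : ℤ => (z : ℚ))


/-! ### Integral criterion for the coset condition -/

lemma mul_apply_self_of_upper {n : ℕ} {A B : Matrix (Fin n) (Fin n) ℤ}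
    (hA : ∀ i j, j < i → A i j = 0) (hB : ∀ i j, j < i → B i j = 0) (i : Fin n) :
    (A * B) i i = A i i * B i i := by
  rw [Matrix.mul_apply]
  refine Finset.sum_eq_single i (fun t _ ht => ?_) (by simp)
  rcases lt_or_gt_of_ne ht with h | h
  · rw [hA i t h, zero_mul]
  · rw [hB t i h, mul_zero]

lemma mul_apply_eq_zero_of_upper {n : ℕ} {A B : Matrix (Fin n) (Fin n) ℤ}
    (hA : ∀ i j, j < i → A i j = 0) (hB : ∀ i j, j < i → B i j = 0) {i j : Fin n} (h : j < i) :
    (A * B) i j = 0 := by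
  rw [Matrix.mul_apply]
  refine Finset.sum_eq_zero fun t _ => ?_
  rcases lt_or_ge t i with h' | h'
  · rw [hA i t h', zero_mul]
  · rw [hB t j (h.trans_le h'), mul_zero]

lemma toQ_mul_mem_rightCoset_iff {n : ℕ} {A B : Matrix (Fin n) (Fin n) ℤ} {d : Fin n → ℤ}
    (hd : ∀ i, 0 < d i) (hA : ∀ i j, j < i → A i j = 0) (hB : ∀ i j, j < i → B i j = 0)
    (hA' : ∀ i, 0 < A i i) (hB' : ∀ i, 0 < B i i) :
    toQ n (A * B) ∈ rightCoset n (Matrix.diagonal fun i => (d i : ℚ)) ↔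
      (∀ i, A i i * B i i = d i) ∧ ∀ i j, d j ∣ (A * B) i j := by
  constructor
  · rintro ⟨γ, ⟨hγ, hdet⟩, h⟩
    choose g hg using hγ
    have hmul : ∀ i j, (A * B) i j = g i j * d j := by
      intro i j
      have := congrFun (congrFun h i) j
      rw [Matrix.mul_diagonal, hg] at this
      simp only [toQ, Matrix.map_apply] at this
      exact_mod_cast this
    have hup : ∀ i j, j < i → g i j = 0 := fun i j hij => by
      have h1 := hmul i j
      rw [mul_apply_eq_zero_of_upper hA hB hij] at h1
      exact (mul_eq_zero.1 h1.symm).resolve_right (hd j).ne'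
    have hpos : ∀ i, 0 < g i i := fun i => by
      have h1 := hmul i i
      rw [mul_apply_self_of_upper hA hB] at h1
      exact pos_of_mul_pos_left (h1 ▸ mul_pos (hA' i) (hB' i)) (hd i).le
    rw [Matrix.det_of_isUpperTriangular (fun i j hij => by rw [hg, hup i j hij, Int.cast_zero])] at hdet
    have hunit : IsUnit (∏ i, g i i) := by
      rw [Int.isUnit_iff]
      simp only [hg] at hdet
      exact_mod_cast hdet
    have hone : ∀ i, g i i = 1 := fun i => by
      have := isUnit_of_dvd_unit (Finset.dvd_prod_of_mem (fun i => g i i) (Finset.mem_univ i)) hunit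
      rcases Int.isUnit_iff.1 this with h1 | h1
      · exact h1
      · have := hpos i
        omega
    exact ⟨fun i => by rw [← mul_apply_self_of_upper hA hB, hmul, hone, one_mul],
      fun i j => ⟨g i j, by rw [hmul, mul_comm]⟩⟩
  · rintro ⟨hdiag, hdvd⟩
    choose g hg using hdvd
    have hup : ∀ i j, j < i → g i j = 0 := fun i j hij => by
      have h1 := hg i j
      rw [mul_apply_eq_zero_of_upper hA hB hij] at h1
      exact (mul_eq_zero.1 h1.symm).resolve_left (hd j).ne'
    have hone : ∀ i, g i i = 1 := fun i => by
      have h1 := hg i i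
      rw [mul_apply_self_of_upper hA hB, hdiag] at h1
      exact (mul_eq_left₀ (hd i).ne').1 h1.symm
    refine ⟨Matrix.of fun i j => (g i j : ℚ), ⟨fun i j => ⟨g i j, rfl⟩, Or.inl ?_⟩, ?_⟩
    · rw [Matrix.det_of_isUpperTriangular (fun i j hij => by simp [hup i j hij])]
      simp [hone]
    · ext i j
      rw [Matrix.mul_diagonal]
      simp only [toQ, Matrix.map_apply, Matrix.of_apply, hg]
      push_cast
      ring

/-! ### Determinantal divisors -/

lemma detDiv_dvd_det_submatrix {n k : ℕ} (C : Matrix (Fin n) (Fin n) ℤ) (f g : Fin k → Fin n) :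
    detDiv n k C ∣ (C.submatrix f g).det := by
  by_cases hf : Function.Injective f
  swap
  · obtain ⟨a, b, hab, hne⟩ : ∃ a b, f a = f b ∧ a ≠ b := by
      simpa [Function.Injective] using hf
    rw [Matrix.det_zero_of_row_eq hne (by ext j; simp [hab])]
    exact dvd_zero _
  by_cases hg : Function.Injective g
  swap
  · obtain ⟨a, b, hab, hne⟩ : ∃ a b, g a = g b ∧ a ≠ b := by
      simpa [Function.Injective] using hg
    rw [Matrix.det_zero_of_column_eq hne (by intro j; simp [hab])]
    exact dvd_zero _
  have hf' := (Tuple.monotone_sort f).strictMono_of_injective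
    (hf.comp (Tuple.sort f).injective)
  have hg' := (Tuple.monotone_sort g).strictMono_of_injective
    (hg.comp (Tuple.sort g).injective)
  have hdvd : detDiv n k C ∣ (C.submatrix (f ∘ Tuple.sort f) (g ∘ Tuple.sort g)).det :=
    Finset.gcd_dvd (f := fun fg : (Fin k → Fin n) × (Fin k → Fin n) =>
      (C.submatrix fg.1 fg.2).det) (b := (f ∘ Tuple.sort f, g ∘ Tuple.sort g))
      (by simpa using ⟨fun a b h => hf' h, fun a b h => hg' h⟩)
  have heq : C.submatrix (f ∘ Tuple.sort f) (g ∘ Tuple.sort g) =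
      ((C.submatrix f g).submatrix (Tuple.sort f) id).submatrix id (Tuple.sort g) := by
    ext; simp
  rw [heq, Matrix.det_permute', Matrix.det_permute, ← mul_assoc] at hdvd
  refine (IsUnit.dvd_mul_left ?_).1 hdvd
  exact IsUnit.mul (by simp) (by simp)

lemma dvd_detDiv {n k : ℕ} {C : Matrix (Fin n) (Fin n) ℤ} {d : ℤ}
    (h : ∀ f g : Fin k → Fin n, Function.Injective f → Function.Injective g →
      d ∣ (C.submatrix f g).det) : d ∣ detDiv n k C := by
  refine Finset.dvd_gcd fun fg hfg => ?_
  simp only [Finset.mem_filter, Finset.mem_univ, true_and] at hfg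
  exact h _ _ (StrictMono.injective fun a b => hfg.1 a b)
    (StrictMono.injective fun a b => hfg.2 a b)

lemma normalize_detDiv {n k : ℕ} (C : Matrix (Fin n) (Fin n) ℤ) :
    normalize (detDiv n k C) = detDiv n k C := Finset.normalize_gcd

/-- If all rows but one are divisible by `p`, so are the `k × k` minors by `p ^ (k - 1)`. -/
lemma pow_dvd_det_submatrix {n k : ℕ} {p : ℤ} {C : Matrix (Fin n) (Fin n) ℤ} {r : Fin n}
    (hC : ∀ i j, i ≠ r → p ∣ C i j) {f g : Fin k → Fin n} (hf : Function.Injective f) :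
    p ^ (k - 1) ∣ (C.submatrix f g).det := by
  have h1 : ∀ i j, ∃ c, C i j = (if i = r then 1 else p) * c := fun i j => by
    by_cases h : i = r
    · exact ⟨C i j, by simp [h]⟩
    · obtain ⟨c, hc⟩ := hC i j h
      exact ⟨c, by simp [h, hc]⟩
  choose c hc using h1
  have h2 : C.submatrix f g = Matrix.diagonal (fun i => if f i = r then 1 else p) *
      (Matrix.of c).submatrix f g := by
    ext i j
    rw [Matrix.diagonal_mul]
    simp [hc (f i) (g j)]
  rw [h2, Matrix.det_mul, Matrix.det_diagonal]
  refine Dvd.dvd.mul_right ?_ _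
  rw [Finset.prod_ite, Finset.prod_const_one, one_mul, Finset.prod_const]
  refine pow_dvd_pow _ ?_
  have hle : (Finset.univ.filter fun i => f i = r).card ≤ 1 :=
    Finset.card_le_one.2 fun a ha b hb => by
      simp only [Finset.mem_filter, Finset.mem_univ, true_and] at ha hb
      exact hf (ha.trans hb.symm)
  have := Finset.card_filter_add_card_filter_not (s := (Finset.univ : Finset (Fin k)))
    (fun i => f i = r)
  simp only [Finset.card_univ, Fintype.card_fin] at this
  omega

lemma detDiv_transpose {n k : ℕ} (C : Matrix (Fin n) (Fin n) ℤ) :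
    detDiv n k Cᵀ = detDiv n k C := by
  have key : ∀ C : Matrix (Fin n) (Fin n) ℤ, detDiv n k C ∣ detDiv n k Cᵀ := fun C =>
    dvd_detDiv fun f g _ _ => by
      rw [← Matrix.det_transpose, Matrix.transpose_submatrix, Matrix.transpose_transpose]
      exact detDiv_dvd_det_submatrix C g f
  rw [← normalize_detDiv, ← normalize_detDiv C]
  exact normalize_eq_normalize (by simpa using key Cᵀ) (key C)

lemma detDiv_self {n : ℕ} (C : Matrix (Fin n) (Fin n) ℤ) : detDiv n n C = normalize C.det := by
  rw [← normalize_detDiv]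
  refine normalize_eq_normalize ?_ (dvd_detDiv fun f g hf hg => ?_)
  · simpa using detDiv_dvd_det_submatrix C id id
  · have heq : C.submatrix f g =
        (C.submatrix (Equiv.ofBijective f (Finite.injective_iff_bijective.1 hf)) id).submatrix id
          (Equiv.ofBijective g (Finite.injective_iff_bijective.1 hg)) := by
      ext; simp
    rw [heq, Matrix.det_permute', Matrix.det_permute]
    exact (dvd_mul_left _ _).mul_left _

/-- A matrix equal to `p` times the identity away from one row, with some entry of that row
off the diagonal prime to `p`, has determinantal divisors `p ^ (k - 1)` for `1 ≤ k < n`. -/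
lemma detDiv_eq_pow_of_row {n k p : ℕ} (hp : p.Prime) {C : Matrix (Fin n) (Fin n) ℤ} {r s : Fin n}
    (hrs : r ≠ s) (hC : ∀ i j, i ≠ r → C i j = if i = j then (p : ℤ) else 0)
    (hs : ¬ (p : ℤ) ∣ C r s) (hrr : C r r = p) (hk : 1 ≤ k) (hkn : k ≤ n - 1) :
    detDiv n k C = (p : ℤ) ^ (k - 1) := by
  obtain ⟨k, rfl⟩ : ∃ k', k = k' + 1 := ⟨k - 1, by omega⟩
  have hcard : Fintype.card (Fin k) ≤ Fintype.card {i : Fin n // i ≠ r ∧ i ≠ s} := by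
    rw [Fintype.card_subtype, Fintype.card_fin]
    have h1 : (Finset.univ.filter fun i : Fin n => i ≠ r ∧ i ≠ s) = ({r, s} : Finset (Fin n))ᶜ := by
      ext i; simp
    rw [h1, Finset.card_compl, Finset.card_pair hrs, Fintype.card_fin]
    omega
  obtain ⟨e⟩ := Function.Embedding.nonempty_of_card_le hcard
  set e' : Fin k → Fin n := fun i => (e i).1 with he'
  have he : Function.Injective e' := fun a b h => e.injective (Subtype.ext h)
  have her : ∀ i, e' i ≠ r := fun i => (e i).2.1
  have hes : ∀ i, e' i ≠ s := fun i => (e i).2.2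
  have hminor : ∀ t, (∀ i, e' i ≠ t) →
      (C.submatrix (Fin.cons r e' : Fin (k + 1) → Fin n) (Fin.cons t e')).det
      = C r t * (p : ℤ) ^ k := by
    intro t ht
    rw [Matrix.det_of_isUpperTriangular, Fin.prod_univ_succ]
    · simp [hC _ _ (her _)]
    · intro i j hij
      simp only [id] at hij
      induction i using Fin.cases with
      | zero => simp at hij
      | succ i =>
        induction j using Fin.cases with
        | zero => simp [hC _ _ (her _), ht]
        | succ j =>
          have : e' i ≠ e' j := fun h => by
            rw [he h] at hij
            exact lt_irrefl _ hij
          simp [hC _ _ (her _), this]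
  have h1 := (detDiv_dvd_det_submatrix C (Fin.cons r e' : Fin (k + 1) → Fin n)
    (Fin.cons r e'))
  have h2 := (detDiv_dvd_det_submatrix C (Fin.cons r e' : Fin (k + 1) → Fin n)
    (Fin.cons s e'))
  rw [hminor _ her, hrr] at h1
  rw [hminor _ hes] at h2
  have hp' : Prime (p : ℤ) := Nat.prime_iff_prime_int.1 hp
  have hcop : IsCoprime (p : ℤ) (C r s) :=
    (Prime.coprime_iff_not_dvd hp').2 hs
  rw [← normalize_detDiv, add_tsub_cancel_right]
  have hn : normalize ((p : ℤ) ^ k) = (p : ℤ) ^ k := Int.normalize_of_nonneg (by positivity)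
  rw [← hn]
  refine normalize_eq_normalize ?_ (dvd_detDiv fun f g hf _ => ?_)
  · obtain ⟨a, b, hab⟩ := hcop
    have : (p : ℤ) ^ k = a * (p * (p : ℤ) ^ k) + b * (C r s * (p : ℤ) ^ k) := by
      linear_combination -(p : ℤ) ^ k * hab
    rw [this]
    exact dvd_add (h1.mul_left _) (h2.mul_left _)
  · refine pow_dvd_det_submatrix (r := r) (fun i j hi => ?_) hf
    rw [hC i j hi]
    split_ifs <;> simp

/-! ### Normal forms of the representatives -/

/-- The exponents on the diagonal of an element of `R₁` with `1` at `a` and `p²` at `b`. -/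
def diagExp {n : ℕ} (a b j : Fin n) : ℕ := if j = a then 0 else if j = b then 2 else 1

/-- `C` is the element of `R₁` with diagonal entry `1` at `a` and `p²` at `b`. -/
structure R1Form {n : ℕ} (p : ℕ) (a b : Fin n) (C : Matrix (Fin n) (Fin n) ℤ) : Prop where
  ne : a ≠ b
  upper : ∀ i j, j < i → C i j = 0
  diag : ∀ j, C j j = (p : ℤ) ^ diagExp a b j
  nonneg : ∀ i j, i < j → 0 ≤ C i j
  lt : ∀ i j, i < j → C i j < C j j
  dvd : ∀ i j, i < j → i ≠ a → (p : ℤ) ∣ C i j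

lemma mem_R1_iff {n p : ℕ} (hp : p.Prime) {C : Matrix (Fin n) (Fin n) ℤ} :
    C ∈ R1 n p ↔ ∃ a b, R1Form p a b C := by
  have h1 : (1 : ℤ) < p := by exact_mod_cast hp.one_lt
  have h2 : (p : ℤ) < (p : ℤ) ^ 2 := by nlinarith
  constructor
  · rintro ⟨hup, hd, ⟨a, ha, ha'⟩, ⟨b, hb, hb'⟩, hlt, hdvd⟩
    refine ⟨a, b, ⟨?_, hup, fun j => ?_, fun i j h => (hlt i j h).1, fun i j h => (hlt i j h).2,
      fun i j h hi => hdvd i j h ?_⟩⟩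
    · rintro rfl
      rw [ha] at hb
      linarith
    · unfold diagExp
      split_ifs with h h'
      · rw [h, ha, pow_zero]
      · rw [h', hb]
      · rcases hd j with h3 | h3 | h3
        · exact absurd (ha' j h3) h
        · rw [h3, pow_one]
        · exact absurd (hb' j h3) h'
    · rcases hd i with h3 | h3 | h3
      · exact absurd (ha' i h3) hi
      · rw [h3]
      · rw [h3]
        exact dvd_pow_self _ two_ne_zero
  · rintro ⟨a, b, h⟩
    refine ⟨h.upper, fun i => ?_, ⟨a, ?_, fun j hj => ?_⟩, ⟨b, ?_, fun j hj => ?_⟩,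
      fun i j hij => ⟨h.nonneg i j hij, h.lt i j hij⟩, fun i j hij hi => h.dvd i j hij ?_⟩
    · rw [h.diag]
      unfold diagExp
      split_ifs <;> simp
    · simp [h.diag, diagExp]
    · simp only [h.diag, diagExp] at hj
      by_contra hne
      rw [if_neg hne] at hj
      split_ifs at hj <;> linarith
    · simp [h.diag, diagExp, h.ne.symm]
    · simp only [h.diag, diagExp] at hj
      by_contra hne
      rw [if_neg hne] at hj
      split_ifs at hj <;> linarith
    · rintro rfl
      rw [h.diag, diagExp, if_pos rfl, pow_zero] at hi
      have := Int.le_of_dvd one_pos hi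
      linarith

namespace R1Form

variable {n p : ℕ} {a b : Fin n} {A C : Matrix (Fin n) (Fin n) ℤ}

lemma diag_left (h : R1Form p a b C) : C a a = 1 := by simp [h.diag, diagExp]

lemma diag_right (h : R1Form p a b C) : C b b = (p : ℤ) ^ 2 := by
  simp [h.diag, diagExp, h.ne.symm]

lemma diag_other (h : R1Form p a b C) {j : Fin n} (ha : j ≠ a) (hb : j ≠ b) : C j j = p := by
  simp [h.diag, diagExp, ha, hb]

lemma col_left (h : R1Form p a b C) {i : Fin n} (hi : i ≠ a) : C i a = 0 := by
  rcases lt_or_gt_of_ne hi with h' | h'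
  · have h1 := h.nonneg i a h'
    have h2 := h.lt i a h'
    rw [h.diag_left] at h2
    omega
  · exact h.upper _ _ h'

lemma lt_prime (h : R1Form p a b C) {i j : Fin n} (hij : i < j) (hj : j ≠ b) (hja : j ≠ a) :
    C i j < p := by
  rw [← h.diag_other hja hj]
  exact h.lt i j hij

lemma dvd_of_ne (h : R1Form p a b C) {i j : Fin n} (hij : i ≠ j) (hi : i ≠ a) :
    (p : ℤ) ∣ C i j := by
  rcases lt_or_gt_of_ne hij with h' | h'
  · exact h.dvd _ _ h' hi
  · rw [h.upper _ _ h']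
    exact dvd_zero _

lemma nonneg_of_ne (h : R1Form p a b C) {i j : Fin n} (hij : i ≠ j) : 0 ≤ C i j := by
  rcases lt_or_gt_of_ne hij with h' | h'
  · exact h.nonneg _ _ h'
  · rw [h.upper _ _ h']

lemma eq_zero (h : R1Form p a b C) {i j : Fin n} (hij : i ≠ j) (hi : i ≠ a) (hj : j ≠ b) :
    C i j = 0 := by
  by_cases hja : j = a
  · subst hja
    exact h.col_left hi
  rcases lt_or_gt_of_ne hij with h' | h'
  · exact Int.eq_zero_of_dvd_of_nonneg_of_lt (h.nonneg _ _ h') (h.lt_prime h' hj hja)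
      (h.dvd _ _ h' hi)
  · exact h.upper _ _ h'

lemma lt_prime_of_ne (hp : 0 < p) (h : R1Form p a b C) {i j : Fin n} (hij : i ≠ j) (hj : j ≠ b) :
    C i j < p := by
  have hp' : (0 : ℤ) < p := by exact_mod_cast hp
  rcases lt_or_gt_of_ne hij with h' | h'
  · by_cases hja : j = a
    · rw [hja, h.col_left (hja ▸ hij)]
      exact hp'
    · exact h.lt_prime h' hj hja
  · rw [h.upper _ _ h']
    exact hp'

lemma lt_sq (hp : 0 < p) (h : R1Form p a b C) {i j : Fin n} (hij : i ≠ j) :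
    C i j < (p : ℤ) ^ 2 := by
  have hp' : (1 : ℤ) ≤ p := by exact_mod_cast hp
  by_cases hj : j = b
  · subst hj
    rcases lt_or_gt_of_ne hij with h' | h'
    · rw [← h.diag_right]
      exact h.lt _ _ h'
    · rw [h.upper _ _ h']
      positivity
  · have := h.lt_prime_of_ne hp hij hj
    nlinarith

lemma diag_pos (hp : 0 < p) (h : R1Form p a b C) (i : Fin n) : 0 < C i i := by
  rw [h.diag]
  positivity

lemma mul_row (h : R1Form p a b C) (B : Matrix (Fin n) (Fin n) ℤ) {i : Fin n} (hi : i ≠ a)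
    (hib : i ≠ b) (j : Fin n) : (C * B) i j = C i i * B i j + C i b * B b j := by
  rw [Matrix.mul_apply]
  exact Fintype.sum_eq_add i b hib fun t ht => by
    rw [h.eq_zero ht.1.symm hi ht.2, zero_mul]

lemma mul_col (h : R1Form p a b C) (A : Matrix (Fin n) (Fin n) ℤ) {j : Fin n} (hj : j ≠ b)
    (hja : j ≠ a) (i : Fin n) : (A * C) i j = A i j * C j j + A i a * C a j := by
  rw [Matrix.mul_apply]
  exact Fintype.sum_eq_add j a hja fun t ht => by
    rw [h.eq_zero ht.1 ht.2 hj, mul_zero]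

lemma mul_col_left (h : R1Form p a b C) (A : Matrix (Fin n) (Fin n) ℤ) (i : Fin n) :
    (A * C) i a = A i a := by
  rw [Matrix.mul_apply, Finset.sum_eq_single a (fun t _ ht => by rw [h.col_left ht, mul_zero])
    (by simp), h.diag_left, mul_one]

/-- An element of `R₁` with all off-diagonal entries zero is diagonal. -/
lemma eq_diagonal (h : R1Form p a b C) (h0 : ∀ i j, i < j → C i j = 0) :
    C = Matrix.diagonal fun i => (p : ℤ) ^ diagExp a b i := by
  ext i j
  rcases lt_trichotomy i j with h' | rfl | h'
  · rw [h0 _ _ h', Matrix.diagonal_apply_ne _ h'.ne]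
  · rw [h.diag, Matrix.diagonal_apply_eq]
  · rw [h.upper _ _ h', Matrix.diagonal_apply_ne _ h'.ne']

lemma diagonal (hp : 0 < p) (hab : a ≠ b) :
    R1Form p a b (Matrix.diagonal fun i => (p : ℤ) ^ diagExp a b i) where
  ne := hab
  upper i j h := Matrix.diagonal_apply_ne _ h.ne'
  diag j := Matrix.diagonal_apply_eq _ _
  nonneg i j h := (Matrix.diagonal_apply_ne _ h.ne).ge
  lt i j h := by
    rw [Matrix.diagonal_apply_ne _ h.ne, Matrix.diagonal_apply_eq]
    positivity
  dvd i j h _ := by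
    rw [Matrix.diagonal_apply_ne _ h.ne]
    exact dvd_zero _

end R1Form

lemma R0_exists_not_dvd {n p : ℕ} (hn : 2 ≤ n) (hp : p.Prime) {C : Matrix (Fin n) (Fin n) ℤ}
    (hC : C ∈ R0 n p) : ∃ i j, i < j ∧ ¬ (p : ℤ) ∣ C i j := by
  obtain ⟨hup, hk, -, hd, -⟩ := hC
  by_contra! hcon
  have h1 := hk 1 le_rfl (by omega)
  have h2 : (p : ℤ) ∣ detDiv n 1 C := dvd_detDiv fun f g _ _ => by
    rw [Matrix.det_fin_one, Matrix.submatrix_apply]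
    rcases lt_trichotomy (f 0) (g 0) with h' | h' | h'
    · exact hcon _ _ h'
    · rw [h', hd]
    · rw [hup _ _ h']
      exact dvd_zero _
  rw [h1, Nat.sub_self, pow_zero] at h2
  exact (Nat.prime_iff_prime_int.1 hp).not_dvd_one h2

lemma R0_minor_dvd {n p : ℕ} (hn : 3 ≤ n) {C : Matrix (Fin n) (Fin n) ℤ}
    (hC : C ∈ R0 n p) (i i' j j' : Fin n) : (p : ℤ) ∣ C i j * C i' j' - C i j' * C i' j := by
  have h1 := detDiv_dvd_det_submatrix C ![i, i'] ![j, j']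
  rw [hC.2.1 2 one_le_two (by omega), Matrix.det_fin_two] at h1
  simpa using h1

/-- The exponents of `diag(p, p², …, p², p³)`. -/
def targetExp {m : ℕ} (i : Fin (m + 2)) : ℕ :=
  if i = 0 then 1 else if i = Fin.last (m + 1) then 3 else 2

/-- The condition that `A * B` lies in the coset of `diag(p, p², …, p², p³)`, for upper triangular
`A`, `B`. -/
def ProductCond {m : ℕ} (p : ℕ) (A B : Matrix (Fin (m + 2)) (Fin (m + 2)) ℤ) : Prop :=
  (∀ i, A i i * B i i = (p : ℤ) ^ targetExp i) ∧ ∀ i j, (p : ℤ) ^ targetExp j ∣ (A * B) i j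

section Classification

variable {m p : ℕ} {A B : Matrix (Fin (m + 2)) (Fin (m + 2)) ℤ} {a b a' b' : Fin (m + 2)}

lemma last_ne_zero' : Fin.last (m + 1) ≠ 0 := Fin.last_pos.ne'

lemma targetExp_zero : targetExp (0 : Fin (m + 2)) = 1 := if_pos rfl

lemma targetExp_last : targetExp (Fin.last (m + 1)) = 3 := by
  simp [targetExp]

lemma targetExp_mid {i : Fin (m + 2)} (h0 : i ≠ 0) (hl : i ≠ Fin.last (m + 1)) :
    targetExp i = 2 := by
  simp [targetExp, h0, hl]

/-- No product of two elements of `R₀` lies in the coset. -/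
lemma not_productCond_R0_R0 (hp : p.Prime) (hA : A ∈ R0 (m + 2) p) (hB : B ∈ R0 (m + 2) p) :
    ¬ ProductCond p A B := fun h => by
  have h0 := h.1 0
  rw [hA.2.2.2.1, hB.2.2.2.1, targetExp_zero, ← pow_two] at h0
  have := Nat.pow_right_injective hp.two_le (by exact_mod_cast h0 : p ^ 2 = p ^ 1)
  omega

lemma exp_of_R0_left (hp : p.Prime) (hA : A ∈ R0 (m + 2) p) (hB : R1Form p a b B)
    (h : ProductCond p A B) : a = 0 ∧ b = Fin.last (m + 1) := by
  have key : ∀ i, 1 + diagExp a b i = targetExp i := fun i => by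
    have h0 := h.1 i
    rw [hA.2.2.2.1, hB.diag, ← pow_succ'] at h0
    have := Nat.pow_right_injective hp.two_le
      (by exact_mod_cast h0 : p ^ (diagExp a b i + 1) = p ^ targetExp i)
    omega
  have h0 := key 0
  have h1 := key (Fin.last _)
  have h2 := @last_ne_zero' m
  simp only [diagExp, targetExp] at h0 h1
  grind

lemma exp_of_R0_right (hp : p.Prime) (hA : R1Form p a b A) (hB : B ∈ R0 (m + 2) p)
    (h : ProductCond p A B) : a = 0 ∧ b = Fin.last (m + 1) := by
  have key : ∀ i, 1 + diagExp a b i = targetExp i := fun i => by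
    have h0 := h.1 i
    rw [hB.2.2.2.1, hA.diag, ← pow_succ] at h0
    have := Nat.pow_right_injective hp.two_le
      (by exact_mod_cast h0 : p ^ (diagExp a b i + 1) = p ^ targetExp i)
    omega
  have h0 := key 0
  have h1 := key (Fin.last _)
  have h2 := @last_ne_zero' m
  simp only [diagExp, targetExp] at h0 h1
  grind

lemma exp_of_R1_R1 (hp : p.Prime) (hA : R1Form p a b A) (hB : R1Form p a' b' B)
    (h : ProductCond p A B) :
    (a ≠ 0 ∧ a ≠ Fin.last (m + 1) ∧ b = Fin.last (m + 1) ∧ a' = 0 ∧ b' = a) ∨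
    (b ≠ 0 ∧ b ≠ Fin.last (m + 1) ∧ a = 0 ∧ a' = b ∧ b' = Fin.last (m + 1)) := by
  have key : ∀ i, diagExp a b i + diagExp a' b' i = targetExp i := fun i => by
    have h0 := h.1 i
    rw [hB.diag, hA.diag, ← pow_add] at h0
    exact Nat.pow_right_injective hp.two_le
      (by exact_mod_cast h0 : p ^ (diagExp a b i + diagExp a' b' i) = p ^ targetExp i)
  have h0 := key 0
  have h1 := key (Fin.last _)
  have h2 := @last_ne_zero' m
  have h3 := key a
  have h4 := key b
  have h5 := key a'
  have h6 := hA.ne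
  have h7 := hB.ne
  simp only [diagExp, targetExp] at h0 h1 h3 h4 h5
  grind (splits := 30)

/-- No product of an element of `R₁` by an element of `R₀` lies in the coset. -/
lemma not_productCond_R1_R0 (hp : p.Prime) (hA : R1Form p a b A) (hB : B ∈ R0 (m + 2) p) :
    ¬ ProductCond p A B := fun h => by
  obtain ⟨rfl, rfl⟩ := exp_of_R0_right hp hA hB h
  have hp0 : (p : ℤ) ≠ 0 := by exact_mod_cast hp.ne_zero
  obtain ⟨i, j, hij, hnd⟩ := R0_exists_not_dvd (by omega) hp hB
  obtain ⟨hup, -, -, hd, hbd⟩ := hB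
  have hrow : ∀ i j, i ≠ 0 → i < j → B i j = 0 := fun i j hi hij => by
    have hil : i ≠ Fin.last _ := (hij.trans_le (Fin.le_last j)).ne
    have hj0 : j ≠ 0 := (Fin.zero_le i |>.trans_lt hij).ne'
    refine Int.eq_zero_of_dvd_of_nonneg_of_lt (hbd _ _ hij).1 (hbd _ _ hij).2 ?_
    have h1 := h.2 i j
    rw [hA.mul_row B hi hil, hA.diag_other hi hil] at h1
    have h2 : (p : ℤ) ^ 2 ∣ (p : ℤ) ^ targetExp j := pow_dvd_pow _ (by
      unfold targetExp; split_ifs <;> omega)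
    have h3 : (p : ℤ) ^ 2 ∣ A i (Fin.last _) * B (Fin.last _) j := by
      by_cases hj : j = Fin.last _
      · rw [hj, hd, pow_two]
        exact mul_dvd_mul_right (hA.dvd_of_ne hil hi) _
      · rw [hup _ _ (lt_of_le_of_ne (Fin.le_last j) hj), mul_zero]
        exact dvd_zero _
    have h4 := (dvd_add_left h3).1 (h2.trans h1)
    rw [pow_two] at h4
    exact (mul_dvd_mul_iff_left hp0).1 h4
  by_cases hi : i = 0
  · subst hi
    have h1 := h.2 0 j
    rw [Matrix.mul_apply, Fintype.sum_eq_add 0 j hij.ne, hA.diag_left, one_mul, hd] at h1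
    · refine hnd ((dvd_add_left (dvd_mul_left _ _)).1 ((dvd_pow_self _ ?_).trans h1))
      unfold targetExp
      split_ifs <;> omega
    · intro t ht
      rcases lt_or_gt_of_ne ht.2 with h' | h'
      · rw [hrow t j ht.1 h', mul_zero]
      · rw [hup _ _ h', mul_zero]
  · exact hnd (hrow i j hi hij ▸ dvd_zero _)

lemma productCond_of_upper (hAu : ∀ i j, j < i → A i j = 0) (hBu : ∀ i j, j < i → B i j = 0)
    (hd : ∀ i, A i i * B i i = (p : ℤ) ^ targetExp i)
    (h : ∀ i j, i < j → (p : ℤ) ^ targetExp j ∣ (A * B) i j) : ProductCond p A B := by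
  refine ⟨hd, fun i j => ?_⟩
  rcases lt_trichotomy i j with h' | rfl | h'
  · exact h i j h'
  · rw [mul_apply_self_of_upper hAu hBu, hd]
  · rw [mul_apply_eq_zero_of_upper hAu hBu h']
    exact dvd_zero _

/-! ### Both factors in `R₁`, with a diagonal left factor -/

/-- The right factors paired with `diag(p, …, 1, …, p²)`, the entry `1` being at `k`. -/
def colFactor (p : ℕ) (k : Fin (m + 2)) (h : Fin (m + 2) → ℤ) :
    Matrix (Fin (m + 2)) (Fin (m + 2)) ℤ :=
  Matrix.of fun i j => if i = j then (p : ℤ) ^ diagExp 0 k j else if j = k then p * h i else 0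

/-- The right factors paired with `diag(1, …, p², …, p)`, the entry `p²` being at `k`. -/
def rowFactor (p : ℕ) (k : Fin (m + 2)) (h : Fin (m + 2) → ℤ) :
    Matrix (Fin (m + 2)) (Fin (m + 2)) ℤ :=
  Matrix.of fun i j => if i = j then (p : ℤ) ^ diagExp k (Fin.last (m + 1)) j
    else if i = k then (if j = Fin.last (m + 1) then p * h j else h j) else 0

variable {k : Fin (m + 2)} {h : Fin (m + 2) → ℤ}

lemma colFactor_R1Form (hp : 0 < p) (hk : k ≠ 0)
    (hh : ∀ i, (i < k → 0 ≤ h i ∧ h i < p) ∧ (¬ i < k → h i = 0)) :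
    R1Form p 0 k (colFactor p k h) where
  ne := hk.symm
  upper i j hij := by
    have := (hh i).2
    simp only [colFactor, Matrix.of_apply, if_neg hij.ne']
    split_ifs with h1
    · rw [this (by rw [← h1]; exact hij.not_gt), mul_zero]
    · rfl
  diag j := by simp [colFactor]
  nonneg i j hij := by
    simp only [colFactor, Matrix.of_apply, if_neg hij.ne]
    split_ifs with h1
    · exact mul_nonneg (by positivity) ((hh i).1 (h1 ▸ hij)).1
    · rfl
  lt i j hij := by
    simp only [colFactor, Matrix.of_apply, if_neg hij.ne, if_true]
    have hp' : (0 : ℤ) < p := by exact_mod_cast hp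
    split_ifs with h1
    · rw [h1, diagExp, if_neg hk, if_pos rfl, pow_two]
      exact mul_lt_mul_of_pos_left ((hh i).1 (h1 ▸ hij)).2 hp'
    · positivity
  dvd i j hij _ := by
    simp only [colFactor, Matrix.of_apply, if_neg hij.ne]
    split_ifs
    · exact dvd_mul_right _ _
    · exact dvd_zero _

lemma rowFactor_R1Form (hp : 0 < p) (hk : k ≠ Fin.last (m + 1))
    (hh : ∀ i, (k < i → 0 ≤ h i ∧ h i < p) ∧ (¬ k < i → h i = 0)) :
    R1Form p k (Fin.last (m + 1)) (rowFactor p k h) where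
  ne := hk
  upper i j hij := by
    have hj := (hij.trans_le (Fin.le_last i)).ne
    simp only [rowFactor, Matrix.of_apply, if_neg hij.ne', if_neg hj]
    split_ifs with h1
    · exact (hh j).2 (by rw [← h1]; exact hij.not_gt)
    · rfl
  diag j := by simp [rowFactor]
  nonneg i j hij := by
    simp only [rowFactor, Matrix.of_apply, if_neg hij.ne]
    split_ifs with h1 h2
    · exact mul_nonneg (by positivity) ((hh j).1 (h1 ▸ hij)).1
    · exact ((hh j).1 (h1 ▸ hij)).1
    · rfl
  lt i j hij := by
    simp only [rowFactor, Matrix.of_apply, if_neg hij.ne, if_true]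
    have hp' : (0 : ℤ) < p := by exact_mod_cast hp
    split_ifs with h1 h2
    · rw [h2, diagExp, if_neg hk.symm, if_pos rfl, pow_two]
      exact mul_lt_mul_of_pos_left (h2 ▸ ((hh j).1 (h1 ▸ hij)).2) hp'
    · rw [diagExp, if_neg (h1 ▸ hij.ne'), if_neg h2, pow_one]
      exact ((hh j).1 (h1 ▸ hij)).2
    · positivity
  dvd i j hij hi := by
    simp only [rowFactor, Matrix.of_apply, if_neg hij.ne, if_neg hi]
    exact dvd_zero _

lemma colFactor_productCond (hp : 0 < p) (hk : k ≠ 0) (hkl : k ≠ Fin.last (m + 1))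
    (hh : ∀ i, (i < k → 0 ≤ h i ∧ h i < p) ∧ (¬ i < k → h i = 0)) :
    ProductCond p (Matrix.diagonal fun i => (p : ℤ) ^ diagExp k (Fin.last (m + 1)) i)
      (colFactor p k h) := by
  have hl := @last_ne_zero' m
  refine productCond_of_upper (R1Form.diagonal hp hkl).upper (colFactor_R1Form hp hk hh).upper
    (fun i => ?_) fun i j hij => ?_
  · rw [Matrix.diagonal_apply_eq, (colFactor_R1Form hp hk hh).diag, ← pow_add]
    congr 1
    simp only [diagExp, targetExp]
    grind (splits := 30)
  · rw [Matrix.diagonal_mul]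
    simp only [colFactor, Matrix.of_apply, if_neg hij.ne]
    split_ifs with h1
    · have hi : i ≠ Fin.last (m + 1) := (hij.trans_le (Fin.le_last j)).ne
      rw [h1, targetExp_mid hk hkl, diagExp, if_neg (h1 ▸ hij.ne), if_neg hi, pow_one,
        ← mul_assoc, ← pow_two]
      exact dvd_mul_right _ _
    · rw [mul_zero]
      exact dvd_zero _

lemma rowFactor_productCond (hp : 0 < p) (hk : k ≠ 0) (hkl : k ≠ Fin.last (m + 1))
    (hh : ∀ i, (k < i → 0 ≤ h i ∧ h i < p) ∧ (¬ k < i → h i = 0)) :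
    ProductCond p (Matrix.diagonal fun i => (p : ℤ) ^ diagExp 0 k i)
      (rowFactor p k h) := by
  have hl := @last_ne_zero' m
  refine productCond_of_upper (R1Form.diagonal hp hk.symm).upper
    (rowFactor_R1Form hp hkl hh).upper (fun i => ?_) fun i j hij => ?_
  · rw [Matrix.diagonal_apply_eq, (rowFactor_R1Form hp hkl hh).diag, ← pow_add]
    congr 1
    simp only [diagExp, targetExp]
    grind (splits := 30)
  · rw [Matrix.diagonal_mul]
    simp only [rowFactor, Matrix.of_apply, if_neg hij.ne]
    have hj : j ≠ 0 := (Fin.zero_le i |>.trans_lt hij).ne'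
    split_ifs with h1 h2
    · rw [h1, h2, targetExp_last, diagExp, if_neg hk, if_pos rfl, ← mul_assoc, ← pow_succ]
      exact dvd_mul_right _ _
    · rw [h1, targetExp_mid hj h2, diagExp, if_neg hk, if_pos rfl]
      exact dvd_mul_right _ _
    · rw [mul_zero]
      exact dvd_zero _

lemma eq_zero_of_pow_dvd {p x : ℤ} {e : ℕ} (h0 : 0 ≤ x) (hx : x < p ^ e) {d : ℕ} (hp : p ≠ 0)
    (h : p ^ (d + e) ∣ p ^ d * x) : x = 0 := by
  rw [pow_add] at h
  exact Int.eq_zero_of_dvd_of_nonneg_of_lt h0 hx ((mul_dvd_mul_iff_left (pow_ne_zero _ hp)).1 h)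

lemma eq_colFactor_of_productCond (hp : p.Prime) (hk : k ≠ 0) (hkl : k ≠ Fin.last (m + 1))
    (hA : R1Form p k (Fin.last (m + 1)) A) (hB : R1Form p 0 k B) (hAB : ProductCond p A B) :
    A = Matrix.diagonal (fun i => (p : ℤ) ^ diagExp k (Fin.last (m + 1)) i) ∧
    ∃ h : Fin (m + 2) → ℤ, (∀ i, (i < k → 0 ≤ h i ∧ h i < p) ∧ (¬ i < k → h i = 0)) ∧
      B = colFactor p k h := by
  have hp0 : (p : ℤ) ≠ 0 := by exact_mod_cast hp.ne_zero
  have hl := @last_ne_zero' m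
  have hB0 : ∀ j, j ≠ 0 → j ≠ k → j ≠ Fin.last (m + 1) → B 0 j = 0 := fun j hj hjk hjl => by
    have h1 := hAB.2 0 j
    rw [targetExp_mid hj hjl, hA.mul_row B hk.symm hl.symm, hA.diag_other hk.symm hl.symm,
      hB.eq_zero hjl.symm hl hjk, mul_zero, add_zero] at h1
    exact eq_zero_of_pow_dvd (d := 1) (e := 1) (hB.nonneg_of_ne hj.symm)
      (by simpa using hB.lt_prime_of_ne hp.pos hj.symm hjk) hp0 (by simpa using h1)
  have hAkj : ∀ j, k < j → A k j = 0 := fun j hj => by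
    have hj0 : j ≠ 0 := (Fin.zero_le k |>.trans_lt hj).ne'
    have h1 := hAB.2 k j
    rw [hB.mul_col A hj.ne' hj0, hA.upper k 0 (Fin.pos_of_ne_zero hk), zero_mul, add_zero,
      hB.diag_other hj0 hj.ne', mul_comm] at h1
    by_cases hjl : j = Fin.last (m + 1)
    · subst hjl
      rw [targetExp_last] at h1
      exact eq_zero_of_pow_dvd (d := 1) (e := 2) (hA.nonneg_of_ne hj.ne)
        (hA.lt_sq hp.pos hj.ne) hp0 (by simpa using h1)
    · rw [targetExp_mid hj0 hjl] at h1
      exact eq_zero_of_pow_dvd (d := 1) (e := 1) (hA.nonneg_of_ne hj.ne)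
        (by simpa using hA.lt_prime_of_ne hp.pos hj.ne hjl) hp0 (by simpa using h1)
  have hil : ∀ i, i ≠ k → i ≠ Fin.last (m + 1) →
      A i (Fin.last (m + 1)) = 0 ∧ B i (Fin.last (m + 1)) = 0 := fun i hik hil => by
    have h1 := hAB.2 i (Fin.last (m + 1))
    rw [targetExp_last, hA.mul_row B hik hil, hA.diag_other hik hil,
      hB.diag_other hl hkl.symm] at h1
    obtain ⟨c, hc⟩ := hA.dvd_of_ne hil hik
    have hb : B i (Fin.last (m + 1)) = 0 := by
      refine eq_zero_of_pow_dvd (p := p) (d := 1) (e := 1) (hB.nonneg_of_ne hil)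
        (by simpa using hB.lt_prime_of_ne hp.pos hil hkl.symm) hp0 ?_
      rw [pow_one]
      refine (dvd_add_left (Dvd.intro c ?_)).1 ((pow_dvd_pow _ (by norm_num)).trans h1)
      rw [hc]
      ring
    refine ⟨?_, hb⟩
    rw [hb, mul_zero, zero_add, mul_comm] at h1
    exact eq_zero_of_pow_dvd (d := 1) (e := 2) (hA.nonneg_of_ne hil)
      (hA.lt_sq hp.pos hil) hp0 (by simpa using h1)
  refine ⟨hA.eq_diagonal fun i j hij => ?_, ?_⟩
  · by_cases hik : i = k
    · subst hik
      exact hAkj j hij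
    by_cases hjl : j = Fin.last (m + 1)
    · subst hjl
      exact (hil i hik hij.ne).1
    · exact hA.eq_zero hij.ne hik hjl
  have hcol : ∀ i, i ≠ k → (p : ℤ) ∣ B i k := fun i hik => by
    by_cases hi : i = 0
    · subst hi
      have h1 := hAB.2 0 k
      rw [targetExp_mid hk hkl, hA.mul_row B hk.symm hl.symm, hA.diag_other hk.symm hl.symm,
        hB.upper _ _ (Fin.lt_last_iff_ne_last.2 hkl), mul_zero, add_zero, pow_two] at h1
      exact (mul_dvd_mul_iff_left hp0).1 h1
    · exact hB.dvd_of_ne hik hi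
  have h2 : ∀ i, ∃ c, i ≠ k → B i k = p * c := fun i => by
    by_cases hik : i = k
    · exact ⟨0, fun h => absurd hik h⟩
    · obtain ⟨c, hc⟩ := hcol i hik
      exact ⟨c, fun _ => hc⟩
  choose c hc using h2
  refine ⟨fun i => if i < k then c i else 0, fun i => ⟨fun h => ?_, fun h => ?_⟩, ?_⟩
  · simp only [if_pos h]
    have h1 := hB.nonneg i k h
    have h2 := hB.lt_sq hp.pos h.ne
    have hpp : (0 : ℤ) < p := by exact_mod_cast hp.pos
    rw [hc i h.ne] at h1 h2
    rw [pow_two] at h2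
    exact ⟨nonneg_of_mul_nonneg_right h1 hpp, lt_of_mul_lt_mul_left h2 hpp.le⟩
  · simp only [if_neg h]
  · ext i j
    simp only [colFactor, Matrix.of_apply]
    by_cases hij : i = j
    · rw [if_pos hij, hij, hB.diag]
    rw [if_neg hij]
    by_cases hj : j = k
    · subst hj
      rw [if_pos rfl]
      split_ifs with h1
      · exact hc i h1.ne
      · rw [mul_zero]
        exact hB.upper _ _ (lt_of_le_of_ne (not_lt.1 h1) (Ne.symm hij))
    rw [if_neg hj]
    by_cases hi : i = 0
    · subst hi
      by_cases hjl : j = Fin.last (m + 1)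
      · subst hjl
        exact (hil 0 hk.symm hij).2
      · exact hB0 j (Ne.symm hij) hj hjl
    · exact hB.eq_zero hij hi hj

lemma eq_rowFactor_of_productCond (hp : p.Prime) (hk : k ≠ 0) (hkl : k ≠ Fin.last (m + 1))
    (hA : R1Form p 0 k A) (hB : R1Form p k (Fin.last (m + 1)) B) (hAB : ProductCond p A B) :
    A = Matrix.diagonal (fun i => (p : ℤ) ^ diagExp 0 k i) ∧
    ∃ h : Fin (m + 2) → ℤ, (∀ i, (k < i → 0 ≤ h i ∧ h i < p) ∧ (¬ k < i → h i = 0)) ∧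
      B = rowFactor p k h := by
  have hp0 : (p : ℤ) ≠ 0 := by exact_mod_cast hp.ne_zero
  have hpp : (0 : ℤ) < p := by exact_mod_cast hp.pos
  have hl := @last_ne_zero' m
  have hAk : ∀ i, i ≠ k → A i k = 0 := fun i hik => by
    have h1 := hAB.2 i k
    rw [targetExp_mid hk hkl, hB.mul_col_left] at h1
    exact Int.eq_zero_of_dvd_of_nonneg_of_lt (hA.nonneg_of_ne hik) (hA.lt_sq hp.pos hik) h1
  have hA0 : ∀ j, j ≠ 0 → j ≠ Fin.last (m + 1) → A 0 j = 0 := fun j hj hjl => by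
    by_cases hjk : j = k
    · subst hjk
      exact hAk 0 hj.symm
    have h1 := hAB.2 0 j
    rw [targetExp_mid hj hjl, hB.mul_col A hjl hjk, hAk 0 hk.symm, zero_mul, add_zero,
      hB.diag_other hjk hjl, mul_comm] at h1
    exact eq_zero_of_pow_dvd (d := 1) (e := 1) (hA.nonneg_of_ne hj.symm)
      (by simpa using hA.lt_prime_of_ne hp.pos hj.symm hjk) hp0 (by simpa using h1)
  have h0l : A 0 (Fin.last (m + 1)) = 0 ∧ B 0 (Fin.last (m + 1)) = 0 := by
    have h1 := hAB.2 0 (Fin.last (m + 1))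
    rw [targetExp_last, Matrix.mul_apply, Fintype.sum_eq_add 0 (Fin.last (m + 1)) hl.symm,
      hA.diag_left, one_mul, hB.diag_right] at h1
    · have hb : B 0 (Fin.last (m + 1)) = 0 := by
        refine Int.eq_zero_of_dvd_of_nonneg_of_lt (hB.nonneg_of_ne hl.symm)
          (hB.lt_sq hp.pos hl.symm) ?_
        exact (dvd_add_left (dvd_mul_left _ _)).1 ((pow_dvd_pow _ (by norm_num)).trans h1)
      refine ⟨?_, hb⟩
      rw [hb, zero_add, mul_comm] at h1
      exact eq_zero_of_pow_dvd (d := 2) (e := 1) (hA.nonneg_of_ne hl.symm)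
        (by simpa using hA.lt_prime_of_ne hp.pos hl.symm hkl.symm) hp0 (by simpa using h1)
    · intro t ht
      rw [hA0 t ht.1 ht.2, zero_mul]
  have hdiag : A = Matrix.diagonal (fun i => (p : ℤ) ^ diagExp 0 k i) := by
    refine hA.eq_diagonal fun i j hij => ?_
    by_cases hi : i = 0
    · subst hi
      by_cases hjl : j = Fin.last (m + 1)
      · subst hjl
        exact h0l.1
      · exact hA0 j hij.ne' hjl
    · by_cases hj : j = k
      · subst hj
        exact hAk i hij.ne
      · exact hA.eq_zero hij.ne hi hj
  refine ⟨hdiag, ?_⟩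
  have hil : ∀ i, i ≠ k → i ≠ Fin.last (m + 1) → B i (Fin.last (m + 1)) = 0 := fun i hik hil => by
    by_cases hi : i = 0
    · subst hi
      exact h0l.2
    have h1 := hAB.2 i (Fin.last (m + 1))
    rw [targetExp_last, hdiag, Matrix.diagonal_mul, diagExp, if_neg hi, if_neg hik] at h1
    exact eq_zero_of_pow_dvd (d := 1) (e := 2) (hB.nonneg_of_ne hil)
      (hB.lt_sq hp.pos hil) hp0 h1
  have hkl' : (p : ℤ) ∣ B k (Fin.last (m + 1)) := by
    have h1 := hAB.2 k (Fin.last (m + 1))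
    rw [targetExp_last, hdiag, Matrix.diagonal_mul, diagExp, if_neg hk, if_pos rfl, pow_succ] at h1
    exact (mul_dvd_mul_iff_left (pow_ne_zero _ hp0)).1 h1
  obtain ⟨c, hc⟩ := hkl'
  refine ⟨fun i => if k < i then (if i = Fin.last (m + 1) then c else B k i) else 0,
    fun i => ⟨fun h => ?_, fun h => if_neg h⟩, ?_⟩
  · simp only [if_pos h]
    split_ifs with h1
    · have h2 := hB.nonneg_of_ne hkl
      have h3 := hB.lt_sq hp.pos hkl
      rw [hc] at h2 h3
      rw [pow_two] at h3
      exact ⟨nonneg_of_mul_nonneg_right h2 hpp, lt_of_mul_lt_mul_left h3 hpp.le⟩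
    · exact ⟨hB.nonneg _ _ h, hB.lt_prime_of_ne hp.pos h.ne h1⟩
  · ext i j
    simp only [rowFactor, Matrix.of_apply]
    by_cases hij : i = j
    · rw [if_pos hij, hij, hB.diag]
    rw [if_neg hij]
    by_cases hi : i = k
    · subst hi
      rw [if_pos rfl]
      by_cases hj : j = Fin.last (m + 1)
      · rw [if_pos hj, hj, hc, if_pos (Fin.lt_last_iff_ne_last.2 hkl), if_pos rfl]
      · rw [if_neg hj, if_neg hj]
        split_ifs with h1
        · rfl
        · exact hB.upper _ _ (lt_of_le_of_ne (not_lt.1 h1) (Ne.symm hij))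
    rw [if_neg hi]
    by_cases hj : j = Fin.last (m + 1)
    · subst hj
      exact hil i hi hij
    · exact hB.eq_zero hij hi hj

/-! ### A left factor in `R₀` -/

/-- The matrix with `p` on the diagonal, first row `f` and last column `g` off the diagonal. -/
def crossMatrix (p : ℕ) (f g : Fin (m + 2) → ℤ) : Matrix (Fin (m + 2)) (Fin (m + 2)) ℤ :=
  Matrix.of fun i j => if i = j then (p : ℤ) else if j = Fin.last (m + 1) then g i
    else if i = 0 then f j else 0

/-- The right factor paired with `crossMatrix p f g`. -/
def crossFactor (p : ℕ) (f g : Fin (m + 2) → ℤ) : Matrix (Fin (m + 2)) (Fin (m + 2)) ℤ :=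
  Matrix.of fun i j => if i = j then (p : ℤ) ^ diagExp 0 (Fin.last (m + 1)) j
    else if j = Fin.last (m + 1) then
      (if i = 0 then (-(∑ t, f t * (-g t % p) + p * g 0)) % (p : ℤ) ^ 2 else p * (-g i % p))
    else if i = 0 then -f j % p else 0

variable {f g : Fin (m + 2) → ℤ}

lemma not_dvd_of_range {p x : ℤ} (h : 0 ≤ x ∧ x < p) (hx : x ≠ 0) : ¬ p ∣ x := fun hd =>
  hx (Int.eq_zero_of_dvd_of_nonneg_of_lt h.1 h.2 hd)

lemma eq_neg_emod_of_dvd {p x y : ℤ} (h0 : 0 ≤ x) (h1 : x < p) (h : p ∣ x + y) : x = -y % p := by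
  rw [← Int.emod_eq_of_lt h0 h1]
  exact Int.emod_eq_emod_iff_emod_sub_eq_zero.2
    (by rw [sub_neg_eq_add]; exact Int.emod_eq_zero_of_dvd h)

lemma dvd_add_neg_emod (p y : ℤ) : p ∣ y + -y % p := by
  have := Int.emod_add_mul_ediv (-y) p
  exact ⟨-(-y / p), by linear_combination this⟩

lemma crossMatrix_apply_of_ne {i j : Fin (m + 2)} (hi : i ≠ 0) (hij : i ≠ j)
    (hj : j ≠ Fin.last (m + 1)) : crossMatrix p f g i j = 0 := by
  simp [crossMatrix, hi, hij, hj]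

lemma crossMatrix_upper (i j : Fin (m + 2)) (hij : j < i) :
    crossMatrix p f g i j = 0 :=
  crossMatrix_apply_of_ne (Fin.zero_le j |>.trans_lt hij).ne' hij.ne'
    (hij.trans_le (Fin.le_last i)).ne

lemma crossMatrix_mem_R0 (hp : p.Prime)
    (hf : ∀ i, (i ≠ 0 ∧ i ≠ Fin.last (m + 1) → 0 ≤ f i ∧ f i < p) ∧
      (¬ (i ≠ 0 ∧ i ≠ Fin.last (m + 1)) → f i = 0))
    (hg : ∀ i, (i ≠ Fin.last (m + 1) → 0 ≤ g i ∧ g i < p) ∧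
      (¬ i ≠ Fin.last (m + 1) → g i = 0))
    (hfg : (f = 0 ∧ g ≠ 0) ∨ (f ≠ 0 ∧ ∀ i, i ≠ 0 → g i = 0)) :
    crossMatrix p f g ∈ R0 (m + 2) p := by
  have hp' : (0 : ℤ) < p := by exact_mod_cast hp.pos
  refine ⟨crossMatrix_upper, fun k hk hkn => ?_, ?_, fun i => ?_, fun i j hij => ?_⟩
  · rcases hfg with ⟨rfl, hg0⟩ | ⟨hf0, hg0⟩
    · obtain ⟨i, hi⟩ := Function.ne_iff.1 hg0
      have hil : i ≠ Fin.last (m + 1) := fun h => hi ((hg i).2 (not_not.2 h))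
      rw [← detDiv_transpose]
      refine detDiv_eq_pow_of_row hp (r := Fin.last (m + 1)) (s := i) hil.symm
        (fun s t hs => ?_) ?_ ?_ hk hkn
      · simp [crossMatrix, hs, eq_comm]
      · simpa [crossMatrix, hil] using not_dvd_of_range ((hg i).1 hil) hi
      · simp [crossMatrix]
    · obtain ⟨j, hj⟩ := Function.ne_iff.1 hf0
      have hjm : j ≠ 0 ∧ j ≠ Fin.last (m + 1) := not_not.1 fun h => hj ((hf j).2 h)
      refine detDiv_eq_pow_of_row hp (r := 0) (s := j) hjm.1.symm
        (fun s t hs => ?_) ?_ ?_ hk hkn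
      · simp [crossMatrix, hs, hg0 s hs]
      · simpa [crossMatrix, hjm, hjm.1.symm] using not_dvd_of_range ((hf j).1 hjm) hj
      · simp [crossMatrix]
  · rw [detDiv_self, Matrix.det_of_isUpperTriangular fun i j hij => crossMatrix_upper i j hij]
    simp [crossMatrix, Int.normalize_of_nonneg]
  · simp [crossMatrix]
  · have hil : i ≠ Fin.last (m + 1) := (hij.trans_le (Fin.le_last j)).ne
    have hj0 : j ≠ 0 := (Fin.zero_le i |>.trans_lt hij).ne'
    simp only [crossMatrix, Matrix.of_apply, if_neg hij.ne]
    split_ifs with h1 h2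
    · exact (hg i).1 hil
    · exact (hf j).1 ⟨hj0, h1⟩
    · exact ⟨le_rfl, hp'⟩

lemma crossMatrix_mul_zero
    (hf : ∀ i, ¬ (i ≠ 0 ∧ i ≠ Fin.last (m + 1)) → f i = 0)
    (B : Matrix (Fin (m + 2)) (Fin (m + 2)) ℤ) (j : Fin (m + 2)) :
    (crossMatrix p f g * B) 0 j =
      p * B 0 j + ∑ t, f t * B t j + g 0 * B (Fin.last (m + 1)) j := by
  have hl := @last_ne_zero' m
  have h1 : ∀ t, crossMatrix p f g 0 t =
      (if t = 0 then (p : ℤ) else 0) + f t + (if t = Fin.last (m + 1) then g 0 else 0) := by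
    intro t
    by_cases h0 : t = 0
    · simp [crossMatrix, h0, hf 0, hl.symm]
    · by_cases h2 : t = Fin.last (m + 1)
      · simp [crossMatrix, h2, hf (Fin.last (m + 1)), hl.symm]
      · simp [crossMatrix, h0, h2, Ne.symm h0]
  rw [Matrix.mul_apply]
  simp only [h1, add_mul, Finset.sum_add_distrib, ite_mul, zero_mul]
  simp

lemma crossMatrix_mul_of_ne {i : Fin (m + 2)} (hi : i ≠ 0) (hil : i ≠ Fin.last (m + 1))
    (B : Matrix (Fin (m + 2)) (Fin (m + 2)) ℤ) (j : Fin (m + 2)) :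
    (crossMatrix p f g * B) i j = p * B i j + g i * B (Fin.last (m + 1)) j := by
  rw [Matrix.mul_apply, Fintype.sum_eq_add i (Fin.last (m + 1)) hil]
  · simp [crossMatrix, hil]
  · intro t ht
    rw [crossMatrix_apply_of_ne hi ht.1.symm ht.2, zero_mul]

lemma crossFactor_R1Form (hp : 0 < p) : R1Form p 0 (Fin.last (m + 1)) (crossFactor p f g) where
  ne := last_ne_zero'.symm
  upper i j hij := by
    simp [crossFactor, hij.ne', (hij.trans_le (Fin.le_last i)).ne,
      (Fin.zero_le j |>.trans_lt hij).ne']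
  diag j := by simp [crossFactor]
  nonneg i j hij := by
    have hp' : (p : ℤ) ≠ 0 := by exact_mod_cast hp.ne'
    simp only [crossFactor, Matrix.of_apply, if_neg hij.ne]
    split_ifs
    · exact Int.emod_nonneg _ (pow_ne_zero _ hp')
    · exact mul_nonneg (by positivity) (Int.emod_nonneg _ hp')
    · exact Int.emod_nonneg _ hp'
    · rfl
  lt i j hij := by
    have hp' : (0 : ℤ) < p := by exact_mod_cast hp
    have hj0 : j ≠ 0 := (Fin.zero_le i |>.trans_lt hij).ne'
    simp only [crossFactor, Matrix.of_apply, if_neg hij.ne, if_true, diagExp, if_neg hj0]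
    split_ifs
    · exact Int.emod_lt_of_pos _ (by positivity)
    · rw [pow_two]
      exact mul_lt_mul_of_pos_left (Int.emod_lt_of_pos _ hp') hp'
    · rw [pow_one]
      exact Int.emod_lt_of_pos _ hp'
    · positivity
  dvd i j hij hi := by
    simp only [crossFactor, Matrix.of_apply, if_neg hij.ne, if_neg hi]
    split_ifs
    · exact dvd_mul_right _ _
    · exact dvd_zero _

/-- The last entry in the first row of the product, when the middle entries of the last column of
`B` are those of `crossFactor p f g`. -/
lemma crossMatrix_mul_zero_last
    (hf : ∀ i, ¬ (i ≠ 0 ∧ i ≠ Fin.last (m + 1)) → f i = 0)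
    (hB : B (Fin.last (m + 1)) (Fin.last (m + 1)) = (p : ℤ) ^ 2)
    (hmid : ∀ i, i ≠ 0 → i ≠ Fin.last (m + 1) → B i (Fin.last (m + 1)) = p * (-g i % p)) :
    (crossMatrix p f g * B) 0 (Fin.last (m + 1)) =
      p * (B 0 (Fin.last (m + 1)) + (∑ t, f t * (-g t % p) + p * g 0)) := by
  have h1 : ∀ t, f t * B t (Fin.last (m + 1)) = p * (f t * (-g t % p)) := fun t => by
    by_cases ht : t ≠ 0 ∧ t ≠ Fin.last (m + 1)
    · rw [hmid t ht.1 ht.2]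
      ring
    · rw [hf t ht]
      ring
  rw [crossMatrix_mul_zero hf, Finset.sum_congr rfl fun t _ => h1 t, ← Finset.mul_sum, hB]
  ring

lemma crossFactor_productCond (hp : 0 < p)
    (hf : ∀ i, (i ≠ 0 ∧ i ≠ Fin.last (m + 1) → 0 ≤ f i ∧ f i < p) ∧
      (¬ (i ≠ 0 ∧ i ≠ Fin.last (m + 1)) → f i = 0)) :
    ProductCond p (crossMatrix p f g) (crossFactor p f g) := by
  have hl := @last_ne_zero' m
  have hB := crossFactor_R1Form (m := m) (f := f) (g := g) hp
  refine productCond_of_upper (crossMatrix_upper) hB.upper (fun i => ?_) fun i j hij => ?_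
  · have h1 : crossMatrix p f g i i = p := by simp [crossMatrix]
    rw [h1, hB.diag, ← pow_succ']
    congr 1
    simp only [diagExp, targetExp]
    grind
  have hil : i ≠ Fin.last (m + 1) := (hij.trans_le (Fin.le_last j)).ne
  have hj0 : j ≠ 0 := (Fin.zero_le i |>.trans_lt hij).ne'
  by_cases hj : j = Fin.last (m + 1)
  · subst hj
    rw [targetExp_last]
    have hmid : ∀ i, i ≠ 0 → i ≠ Fin.last (m + 1) →
        crossFactor p f g i (Fin.last (m + 1)) = p * (-g i % p) := fun i h1 h2 => by
      simp [crossFactor, h1, h2]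
    by_cases hi : i = 0
    · subst hi
      have h0 : crossFactor p f g 0 (Fin.last (m + 1)) =
          (-(∑ t, f t * (-g t % p) + p * g 0)) % (p : ℤ) ^ 2 := by
        simp [crossFactor, hl.symm]
      rw [crossMatrix_mul_zero_last (fun i => (hf i).2) hB.diag_right hmid, pow_succ', h0,
        add_comm ((-_) % _)]
      exact mul_dvd_mul_left _ (dvd_add_neg_emod _ _)
    · rw [crossMatrix_mul_of_ne hi hil, hmid i hi hil, hB.diag_right]
      obtain ⟨c, hc⟩ := dvd_add_neg_emod p (g i)
      exact ⟨c, by linear_combination (p : ℤ) ^ 2 * hc⟩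
  · rw [targetExp_mid hj0 hj, hB.mul_col _ hj hj0, hB.diag_other hj0 hj]
    by_cases hi : i = 0
    · subst hi
      have h1 : crossMatrix p f g 0 j = f j := by simp [crossMatrix, hj, hj0.symm]
      have h2 : crossMatrix p f g 0 0 = p := by simp [crossMatrix]
      have h3 : crossFactor p f g 0 j = -f j % p := by simp [crossFactor, hj, hj0.symm]
      obtain ⟨c, hc⟩ := dvd_add_neg_emod p (f j)
      rw [h1, h2, h3]
      exact ⟨c, by linear_combination (p : ℤ) * hc⟩
    · rw [crossMatrix_apply_of_ne hi hij.ne hj, crossMatrix_apply_of_ne hi hi hl.symm]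
      simp

lemma eq_crossFactor_of_productCond (hm : 1 ≤ m) (hp : p.Prime) (hA : A ∈ R0 (m + 2) p)
    (hB : R1Form p 0 (Fin.last (m + 1)) B) (hAB : ProductCond p A B) :
    ∃ f g : Fin (m + 2) → ℤ,
      (∀ i, (i ≠ 0 ∧ i ≠ Fin.last (m + 1) → 0 ≤ f i ∧ f i < p) ∧
        (¬ (i ≠ 0 ∧ i ≠ Fin.last (m + 1)) → f i = 0)) ∧
      (∀ i, (i ≠ Fin.last (m + 1) → 0 ≤ g i ∧ g i < p) ∧
        (¬ i ≠ Fin.last (m + 1) → g i = 0)) ∧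
      ((f = 0 ∧ g ≠ 0) ∨ (f ≠ 0 ∧ ∀ i, i ≠ 0 → g i = 0)) ∧
      A = crossMatrix p f g ∧ B = crossFactor p f g := by
  have hp0 : (p : ℤ) ≠ 0 := by exact_mod_cast hp.ne_zero
  have hpp : (0 : ℤ) < p := by exact_mod_cast hp.pos
  have hl := @last_ne_zero' m
  obtain ⟨r, s, hrs, hnd⟩ := R0_exists_not_dvd (by omega) hp hA
  have hminor := R0_minor_dvd (by omega) hA
  obtain ⟨hup, -, -, hd, hbd⟩ := hA
  have hA0 : ∀ i j, i ≠ 0 → i ≠ j → j ≠ Fin.last (m + 1) → A i j = 0 := fun i j hi hij hj => by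
    rcases lt_or_gt_of_ne hij with h' | h'
    · have hj0 : j ≠ 0 := (Fin.zero_le i |>.trans_lt h').ne'
      have h1 := hAB.2 i j
      rw [targetExp_mid hj0 hj, hB.mul_col A hj hj0, hB.diag_other hj0 hj,
        hup i 0 (Fin.pos_of_ne_zero hi), zero_mul, add_zero, mul_comm] at h1
      exact eq_zero_of_pow_dvd (d := 1) (e := 1) (hbd i j h').1 (by simpa using (hbd i j h').2)
        hp0 (by simpa using h1)
    · exact hup _ _ h'
  set f : Fin (m + 2) → ℤ := fun j => if j ≠ 0 ∧ j ≠ Fin.last (m + 1) then A 0 j else 0 with hfdef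
  set g : Fin (m + 2) → ℤ := fun i => if i ≠ Fin.last (m + 1) then A i (Fin.last (m + 1)) else 0
    with hgdef
  have hf : ∀ i, (i ≠ 0 ∧ i ≠ Fin.last (m + 1) → 0 ≤ f i ∧ f i < p) ∧
        (¬ (i ≠ 0 ∧ i ≠ Fin.last (m + 1)) → f i = 0) := fun i =>
    ⟨fun h => by simpa only [hfdef, if_pos h] using hbd _ _ (Fin.pos_of_ne_zero h.1),
      fun h => by simp only [hfdef, if_neg h]⟩
  have hg : ∀ i, (i ≠ Fin.last (m + 1) → 0 ≤ g i ∧ g i < p) ∧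
        (¬ i ≠ Fin.last (m + 1) → g i = 0) := fun i =>
    ⟨fun h => by simpa only [hgdef, if_pos h] using hbd _ _ (Fin.lt_last_iff_ne_last.2 h),
      fun h => by simp only [hgdef, if_neg h]⟩
  have hAfg : A = crossMatrix p f g := by
    ext i j
    simp only [crossMatrix, Matrix.of_apply]
    by_cases hij : i = j
    · rw [if_pos hij, hij, hd]
    rw [if_neg hij]
    by_cases hj : j = Fin.last (m + 1)
    · subst hj
      rw [if_pos rfl]
      simp only [hgdef, if_pos (show i ≠ Fin.last (m + 1) from hij)]
    rw [if_neg hj]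
    by_cases hi : i = 0
    · subst hi
      rw [if_pos rfl]
      simp only [hfdef, if_pos (And.intro (Ne.symm hij) hj)]
    · rw [if_neg hi, hA0 i j hi hij hj]
  refine ⟨f, g, hf, hg, ?_, hAfg, ?_⟩
  · by_cases hf0 : f = 0
    · refine Or.inl ⟨hf0, fun hg0 => hnd ?_⟩
      rw [hAfg, hf0, hg0]
      simp [crossMatrix, hrs.ne]
    · refine Or.inr ⟨hf0, fun i hi => ?_⟩
      by_cases hil : i = Fin.last (m + 1)
      · exact (hg i).2 (not_not.2 hil)
      obtain ⟨j, hj⟩ := Function.ne_iff.1 hf0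
      have hjm : j ≠ 0 ∧ j ≠ Fin.last (m + 1) := not_not.1 fun h => hj ((hf j).2 h)
      have h1 := hminor 0 i j (Fin.last (m + 1))
      have hAi : (p : ℤ) ∣ A i j := by
        by_cases hij : i = j
        · rw [hij, hd]
        · rw [hA0 i j hi hij hjm.2]
          exact dvd_zero _
      have h2 := (dvd_sub_left (hAi.mul_left _)).1 h1
      have h3 : A 0 j = f j := by simp only [hfdef, if_pos hjm]
      have h4 : A i (Fin.last (m + 1)) = g i := by
        simp only [hgdef, if_pos (show i ≠ Fin.last (m + 1) from hil)]
      rw [h3, h4] at h2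
      rcases (Nat.prime_iff_prime_int.1 hp).dvd_or_dvd h2 with h5 | h5
      · exact absurd h5 (not_dvd_of_range ((hf j).1 hjm) hj)
      · exact Int.eq_zero_of_dvd_of_nonneg_of_lt ((hg i).1 hil).1 ((hg i).1 hil).2 h5
  · rw [hAfg] at hAB
    have hmid : ∀ i, i ≠ 0 → i ≠ Fin.last (m + 1) →
        B i (Fin.last (m + 1)) = p * (-g i % p) := fun i hi hil => by
      obtain ⟨c, hc⟩ := hB.dvd_of_ne hil hi
      have h1 := hAB.2 i (Fin.last (m + 1))
      rw [crossMatrix_mul_of_ne hi hil, hB.diag_right, targetExp_last, hc] at h1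
      have h2 : (p : ℤ) * (p * c) + g i * (p : ℤ) ^ 2 = (p : ℤ) ^ 2 * (c + g i) := by ring
      rw [h2, pow_succ] at h1
      have h3 := hB.nonneg_of_ne hil
      have h4 := hB.lt_sq hp.pos hil
      rw [hc] at h3 h4
      rw [pow_two] at h4
      rw [hc, ← eq_neg_emod_of_dvd (nonneg_of_mul_nonneg_right h3 hpp)
        (lt_of_mul_lt_mul_left h4 hpp.le) ((mul_dvd_mul_iff_left (pow_ne_zero _ hp0)).1 h1)]
    ext i j
    simp only [crossFactor, Matrix.of_apply]
    by_cases hij : i = j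
    · rw [if_pos hij, hij, hB.diag]
    rw [if_neg hij]
    by_cases hj : j = Fin.last (m + 1)
    · subst hj
      rw [if_pos rfl]
      by_cases hi : i = 0
      · subst hi
        rw [if_pos rfl]
        have h1 := hAB.2 0 (Fin.last (m + 1))
        rw [crossMatrix_mul_zero_last (fun i => (hf i).2) hB.diag_right hmid, targetExp_last,
          pow_succ'] at h1
        exact eq_neg_emod_of_dvd (hB.nonneg_of_ne hij) (hB.lt_sq hp.pos hij)
          ((mul_dvd_mul_iff_left hp0).1 h1)
      · rw [if_neg hi, hmid i hi hij]
    rw [if_neg hj]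
    by_cases hi : i = 0
    · subst hi
      have hj0 : j ≠ 0 := Ne.symm hij
      have h1 := hAB.2 0 j
      have h2 : crossMatrix p f g 0 j = f j := by simp [crossMatrix, hj, hij]
      have h3 : crossMatrix p f g 0 0 = p := by simp [crossMatrix]
      rw [targetExp_mid hj0 hj, hB.mul_col _ hj hj0, hB.diag_other hj0 hj, h2, h3,
        mul_comm (f j), ← mul_add, pow_two, add_comm] at h1
      rw [if_pos rfl]
      exact eq_neg_emod_of_dvd (hB.nonneg_of_ne hij) (hB.lt_prime_of_ne hp.pos hij hj)
        ((mul_dvd_mul_iff_left hp0).1 h1)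
    · rw [if_neg hi, hB.eq_zero hij hi hj]
end Classification

/-! ### Counting -/

/-- The functions with values in `[0, p)` that vanish where `P` fails. -/
noncomputable def supportedOn {n : ℕ} (p : ℕ) (P : Fin n → Prop) [DecidablePred P] :
    Finset (Fin n → ℤ) :=
  Fintype.piFinset fun i => if P i then Finset.Ico (0 : ℤ) p else {0}

lemma mem_supportedOn {n p : ℕ} {P : Fin n → Prop} [DecidablePred P] {h : Fin n → ℤ} :
    h ∈ supportedOn p P ↔ ∀ i, (P i → 0 ≤ h i ∧ h i < p) ∧ (¬ P i → h i = 0) := by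
  rw [supportedOn, Fintype.mem_piFinset]
  refine forall_congr' fun i => ?_
  split_ifs with hP <;> simp [hP]

lemma card_supportedOn {n p : ℕ} {P : Fin n → Prop} [DecidablePred P] :
    (supportedOn p P).card = p ^ (Finset.univ.filter P).card := by
  rw [supportedOn, Fintype.card_piFinset, ← Finset.prod_const, Finset.prod_filter]
  refine Finset.prod_congr rfl fun i _ => ?_
  split_ifs <;> simp

lemma zero_mem_supportedOn {n p : ℕ} (hp : 0 < p) {P : Fin n → Prop} [DecidablePred P] :
    (0 : Fin n → ℤ) ∈ supportedOn p P :=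
  mem_supportedOn.2 fun _ => ⟨fun _ => ⟨le_rfl, Int.natCast_pos.2 hp⟩, fun _ => rfl⟩

/-- The first rows and last columns of the left factors in `R₀`. -/
noncomputable def crossParams (m p : ℕ) : Finset ((Fin (m + 2) → ℤ) × (Fin (m + 2) → ℤ)) :=
  {0} ×ˢ (supportedOn p fun i => i ≠ Fin.last (m + 1)).erase 0 ∪
    (supportedOn p fun i => i ≠ 0 ∧ i ≠ Fin.last (m + 1)).erase 0 ×ˢ supportedOn p fun i => i = 0

lemma mem_crossParams {m p : ℕ} (hp : 0 < p) {fg : (Fin (m + 2) → ℤ) × (Fin (m + 2) → ℤ)} :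
    fg ∈ crossParams m p ↔
      (∀ i, (i ≠ 0 ∧ i ≠ Fin.last (m + 1) → 0 ≤ fg.1 i ∧ fg.1 i < p) ∧
        (¬ (i ≠ 0 ∧ i ≠ Fin.last (m + 1)) → fg.1 i = 0)) ∧
      (∀ i, (i ≠ Fin.last (m + 1) → 0 ≤ fg.2 i ∧ fg.2 i < p) ∧
        (¬ i ≠ Fin.last (m + 1) → fg.2 i = 0)) ∧
      ((fg.1 = 0 ∧ fg.2 ≠ 0) ∨ (fg.1 ≠ 0 ∧ ∀ i, i ≠ 0 → fg.2 i = 0)) := by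
  have hl := @last_ne_zero' m
  have hp' : (0 : ℤ) < p := by exact_mod_cast hp
  rw [← mem_supportedOn, ← mem_supportedOn, crossParams]
  simp only [Finset.mem_union, Finset.mem_product, Finset.mem_singleton, Finset.mem_erase]
  constructor
  · rintro (⟨h1, h2, h3⟩ | ⟨⟨h1, h2⟩, h3⟩)
    · exact ⟨h1 ▸ zero_mem_supportedOn hp, h3, Or.inl ⟨h1, h2⟩⟩
    · rw [mem_supportedOn] at h3
      refine ⟨h2, mem_supportedOn.2 fun i => ?_, Or.inr ⟨h1, fun i hi => (h3 i).2 hi⟩⟩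
      by_cases hi : i = 0
      · exact ⟨fun _ => (h3 i).1 hi, fun h => absurd (hi ▸ not_not.1 h) hl.symm⟩
      · rw [(h3 i).2 hi]
        exact ⟨fun _ => ⟨le_rfl, hp'⟩, fun _ => rfl⟩
  · rintro ⟨h1, h2, ⟨h3, h4⟩ | ⟨h3, h4⟩⟩
    · exact Or.inl ⟨h3, h4, h2⟩
    · refine Or.inr ⟨⟨h3, h1⟩, mem_supportedOn.2 fun i => ⟨fun hi => ?_, h4 i⟩⟩
      exact (mem_supportedOn.1 h2 i).1 (hi ▸ hl.symm)

lemma card_filter_ne_last (m : ℕ) :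
    (Finset.univ.filter fun i : Fin (m + 2) => i ≠ Fin.last (m + 1)).card = m + 1 := by
  rw [Finset.filter_ne', Finset.card_erase_of_mem (Finset.mem_univ _)]
  simp

lemma card_filter_mid (m : ℕ) :
    (Finset.univ.filter fun i : Fin (m + 2) => i ≠ 0 ∧ i ≠ Fin.last (m + 1)).card = m := by
  have h : (Finset.univ.filter fun i : Fin (m + 2) => i ≠ 0 ∧ i ≠ Fin.last (m + 1)) =
      ({0, Fin.last (m + 1)} : Finset (Fin (m + 2)))ᶜ := by
    ext i
    simp
  rw [h, Finset.card_compl, Finset.card_pair last_ne_zero'.symm, Fintype.card_fin]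
  omega

lemma card_crossParams {m p : ℕ} (hp : 0 < p) :
    (crossParams m p).card = (p ^ (m + 1) - 1) + (p ^ m - 1) * p := by
  rw [crossParams, Finset.card_union_of_disjoint, Finset.card_product, Finset.card_product,
    Finset.card_singleton, one_mul, Finset.card_erase_of_mem (zero_mem_supportedOn hp),
    Finset.card_erase_of_mem (zero_mem_supportedOn hp), card_supportedOn, card_supportedOn,
    card_supportedOn, card_filter_ne_last, card_filter_mid, Finset.filter_eq',
    if_pos (Finset.mem_univ _), Finset.card_singleton, pow_one]
  rw [Finset.disjoint_left]
  intro fg h1 h2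
  simp only [Finset.mem_product, Finset.mem_singleton, Finset.mem_erase] at h1 h2
  exact h2.1.1 h1.1

/-- The positions `k` together with the entries of the column above position `k`. -/
noncomputable def colParams (m p : ℕ) : Finset (Σ _ : Fin (m + 2), Fin (m + 2) → ℤ) :=
  (Finset.univ.filter fun k : Fin (m + 2) => k ≠ 0 ∧ k ≠ Fin.last (m + 1)).sigma
    fun k => supportedOn p fun i => i < k

/-- The positions `k` together with the entries of the row to the right of position `k`. -/
noncomputable def rowParams (m p : ℕ) : Finset (Σ _ : Fin (m + 2), Fin (m + 2) → ℤ) :=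
  (Finset.univ.filter fun k : Fin (m + 2) => k ≠ 0 ∧ k ≠ Fin.last (m + 1)).sigma
    fun k => supportedOn p fun i => k < i

lemma sum_filter_mid (m : ℕ) (F : Fin (m + 2) → ℕ) :
    ∑ k ∈ Finset.univ.filter (fun k : Fin (m + 2) => k ≠ 0 ∧ k ≠ Fin.last (m + 1)), F k =
      ∑ k : Fin m, F k.castSucc.succ := by
  rw [Finset.sum_filter, Fin.sum_univ_succ, Fin.sum_univ_castSucc]
  simp [Fin.succ_ne_zero, Fin.castSucc_ne_last, ← Fin.succ_last]

lemma card_colParams (m p : ℕ) :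
    (colParams m p).card = ∑ i ∈ Finset.range m, p ^ (i + 1) := by
  rw [colParams, Finset.card_sigma, sum_filter_mid,
    ← Fin.sum_univ_eq_sum_range (fun i => p ^ (i + 1))]
  refine Finset.sum_congr rfl fun k _ => ?_
  rw [card_supportedOn, Finset.filter_gt_eq_Iio, Fin.card_Iio]
  simp

lemma card_rowParams (m p : ℕ) :
    (rowParams m p).card = ∑ i ∈ Finset.range m, p ^ (i + 1) := by
  rw [rowParams, Finset.card_sigma, sum_filter_mid, ← Finset.sum_range_reflect,
    ← Fin.sum_univ_eq_sum_range (fun i => p ^ (m - 1 - i + 1))]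
  refine Finset.sum_congr rfl fun k _ => ?_
  rw [card_supportedOn, Finset.filter_lt_eq_Ioi, Fin.card_Ioi]
  congr 1
  have := k.isLt
  simp
  omega

/-- The pairs of representatives with left factor in `R₀`. -/
def crossPair (m p : ℕ) (fg : (Fin (m + 2) → ℤ) × (Fin (m + 2) → ℤ)) :
    Matrix (Fin (m + 2)) (Fin (m + 2)) ℤ × Matrix (Fin (m + 2)) (Fin (m + 2)) ℤ :=
  (crossMatrix p fg.1 fg.2, crossFactor p fg.1 fg.2)

/-- The pairs of representatives whose left factor has last diagonal entry `p²`. -/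
def colPair (m p : ℕ) (kh : Σ _ : Fin (m + 2), Fin (m + 2) → ℤ) :
    Matrix (Fin (m + 2)) (Fin (m + 2)) ℤ × Matrix (Fin (m + 2)) (Fin (m + 2)) ℤ :=
  (Matrix.diagonal fun i => (p : ℤ) ^ diagExp kh.1 (Fin.last (m + 1)) i, colFactor p kh.1 kh.2)

/-- The pairs of representatives whose left factor has first diagonal entry `1`. -/
def rowPair (m p : ℕ) (kh : Σ _ : Fin (m + 2), Fin (m + 2) → ℤ) :
    Matrix (Fin (m + 2)) (Fin (m + 2)) ℤ × Matrix (Fin (m + 2)) (Fin (m + 2)) ℤ :=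
  (Matrix.diagonal fun i => (p : ℤ) ^ diagExp 0 kh.1 i, rowFactor p kh.1 kh.2)

lemma crossPair_injOn {m p : ℕ} (hp : 0 < p) : Set.InjOn (crossPair m p) (crossParams m p) := by
  rintro ⟨f, g⟩ h1 ⟨f', g'⟩ h2 h
  rw [Finset.mem_coe, mem_crossParams hp] at h1 h2
  have hA : ∀ i j, crossMatrix p f g i j = crossMatrix p f' g' i j :=
    fun i j => congrFun (congrFun (congrArg Prod.fst h) i) j
  refine Prod.ext (funext fun j => ?_) (funext fun i => ?_)
  · by_cases hj : j ≠ 0 ∧ j ≠ Fin.last (m + 1)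
    · simpa [crossMatrix, hj.1.symm, hj.2] using hA 0 j
    · exact ((h1.1 j).2 hj).trans ((h2.1 j).2 hj).symm
  · by_cases hi : i ≠ Fin.last (m + 1)
    · simpa [crossMatrix, hi] using hA i (Fin.last (m + 1))
    · exact ((h1.2.1 i).2 hi).trans ((h2.2.1 i).2 hi).symm

lemma mem_colParams {m p : ℕ} {kh : Σ _ : Fin (m + 2), Fin (m + 2) → ℤ} :
    kh ∈ colParams m p ↔ (kh.1 ≠ 0 ∧ kh.1 ≠ Fin.last (m + 1)) ∧
      ∀ i, (i < kh.1 → 0 ≤ kh.2 i ∧ kh.2 i < p) ∧ (¬ i < kh.1 → kh.2 i = 0) := by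
  rw [colParams, Finset.mem_sigma, mem_supportedOn, Finset.mem_filter]
  simp

lemma mem_rowParams {m p : ℕ} {kh : Σ _ : Fin (m + 2), Fin (m + 2) → ℤ} :
    kh ∈ rowParams m p ↔ (kh.1 ≠ 0 ∧ kh.1 ≠ Fin.last (m + 1)) ∧
      ∀ i, (kh.1 < i → 0 ≤ kh.2 i ∧ kh.2 i < p) ∧ (¬ kh.1 < i → kh.2 i = 0) := by
  rw [rowParams, Finset.mem_sigma, mem_supportedOn, Finset.mem_filter]
  simp

/-- A diagonal matrix `diag(p ^ diagExp a b)` determines the exponents. -/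
lemma diagExp_eq_of_diagonal_eq {n p : ℕ} (hp : p.Prime) {a b a' b' : Fin n}
    (h : Matrix.diagonal (fun i => (p : ℤ) ^ diagExp a b i) =
      Matrix.diagonal fun i => (p : ℤ) ^ diagExp a' b' i) (i : Fin n) :
    diagExp a b i = diagExp a' b' i := by
  have h1 := congrFun (Matrix.diagonal_injective h) i
  exact Nat.pow_right_injective hp.two_le
    (by exact_mod_cast h1 : p ^ diagExp a b i = p ^ diagExp a' b' i)

lemma colPair_injOn {m p : ℕ} (hp : p.Prime) : Set.InjOn (colPair m p) (colParams m p) := by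
  rintro ⟨k, h⟩ h1 ⟨k', h'⟩ h2 heq
  rw [Finset.mem_coe, mem_colParams] at h1 h2
  have hk : k = k' := by
    have h3 := diagExp_eq_of_diagonal_eq hp (congrArg Prod.fst heq) k
    simp only [diagExp] at h3
    grind
  subst hk
  congr 1
  funext i
  by_cases hi : i < k
  · have hB : colFactor p k h i k = colFactor p k h' i k :=
      congrFun (congrFun (congrArg Prod.snd heq) i) k
    simpa [colFactor, hi.ne, hp.ne_zero] using hB
  · exact ((h1.2 i).2 hi).trans ((h2.2 i).2 hi).symm

lemma rowPair_injOn {m p : ℕ} (hp : p.Prime) : Set.InjOn (rowPair m p) (rowParams m p) := by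
  rintro ⟨k, h⟩ h1 ⟨k', h'⟩ h2 heq
  rw [Finset.mem_coe, mem_rowParams] at h1 h2
  have hk : k = k' := by
    have h3 := diagExp_eq_of_diagonal_eq hp (congrArg Prod.fst heq) k
    simp only [diagExp] at h3
    grind
  subst hk
  congr 1
  funext i
  by_cases hi : k < i
  · have hB : rowFactor p k h k i = rowFactor p k h' k i :=
      congrFun (congrFun (congrArg Prod.snd heq) k) i
    by_cases hil : i = Fin.last (m + 1)
    · subst hil
      simpa [rowFactor, hi.ne, hp.ne_zero] using hB
    · simpa [rowFactor, hi.ne, hil] using hB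
  · exact ((h1.2 i).2 hi).trans ((h2.2 i).2 hi).symm

/-- The pairs of representatives whose product lies in the coset. -/
noncomputable def cosetPairs (m p : ℕ) :
    Finset (Matrix (Fin (m + 2)) (Fin (m + 2)) ℤ × Matrix (Fin (m + 2)) (Fin (m + 2)) ℤ) :=
  (crossParams m p).image (crossPair m p) ∪ (colParams m p).image (colPair m p) ∪
    (rowParams m p).image (rowPair m p)

lemma card_cosetPairs {m p : ℕ} (hp : p.Prime) :
    (cosetPairs m p).card =
      (p ^ (m + 1) - 1) + (p ^ m - 1) * p + 2 * ∑ i ∈ Finset.range m, p ^ (i + 1) := by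
  have h1 : (1 : ℤ) < p := by exact_mod_cast hp.one_lt
  have hl := @last_ne_zero' m
  rw [cosetPairs, Finset.card_union_of_disjoint, Finset.card_union_of_disjoint,
    Finset.card_image_of_injOn (crossPair_injOn hp.pos),
    Finset.card_image_of_injOn (colPair_injOn hp), Finset.card_image_of_injOn (rowPair_injOn hp),
    card_crossParams hp.pos, card_colParams, card_rowParams, two_mul, ← add_assoc]
  · rw [Finset.disjoint_left]
    intro CC hx hy
    obtain ⟨fg, -, rfl⟩ := Finset.mem_image.1 hx
    obtain ⟨kh, hkh, h⟩ := Finset.mem_image.1 hy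
    rw [mem_colParams] at hkh
    have h2 := congrFun (congrFun (congrArg Prod.fst h) (Fin.last _)) (Fin.last _)
    simp only [colPair, crossPair, Matrix.diagonal_apply_eq, crossMatrix, Matrix.of_apply,
      diagExp, if_true, if_neg hkh.1.2.symm] at h2
    nlinarith
  · rw [Finset.disjoint_left]
    intro CC hx hy
    obtain ⟨kh, hkh, h⟩ := Finset.mem_image.1 hy
    have h2 := congrFun (congrFun (congrArg Prod.fst h) 0) 0
    simp only [rowPair, Matrix.diagonal_apply_eq, diagExp, if_true, pow_zero] at h2
    rcases Finset.mem_union.1 hx with hx | hx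
    · obtain ⟨fg, -, rfl⟩ := Finset.mem_image.1 hx
      simp only [crossPair, crossMatrix, Matrix.of_apply, if_true] at h2
      linarith
    · obtain ⟨kh', hkh', rfl⟩ := Finset.mem_image.1 hx
      rw [mem_colParams] at hkh'
      simp only [colPair, Matrix.diagonal_apply_eq, diagExp, if_neg hkh'.1.1.symm,
        if_neg hl.symm] at h2
      linarith

lemma mem_cosetPairs_iff {m p : ℕ} (hm : 1 ≤ m) (hp : p.Prime)
    {A B : Matrix (Fin (m + 2)) (Fin (m + 2)) ℤ} :
    (A, B) ∈ cosetPairs m p ↔ A ∈ R0 (m + 2) p ∪ R1 (m + 2) p ∧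
      B ∈ R0 (m + 2) p ∪ R1 (m + 2) p ∧ ProductCond p A B := by
  simp only [cosetPairs, Finset.mem_union, Finset.mem_image, Set.mem_union, or_assoc]
  constructor
  · rintro (⟨fg, hfg, h⟩ | ⟨kh, hkh, h⟩ | ⟨kh, hkh, h⟩) <;> obtain ⟨rfl, rfl⟩ := Prod.mk.inj h
    · obtain ⟨hf, hg, hfg⟩ := (mem_crossParams hp.pos).1 hfg
      exact ⟨Or.inl (crossMatrix_mem_R0 hp hf hg hfg),
        Or.inr ((mem_R1_iff hp).2 ⟨_, _, crossFactor_R1Form hp.pos⟩),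
        crossFactor_productCond hp.pos hf⟩
    · obtain ⟨⟨h0, h1⟩, h2⟩ := mem_colParams.1 hkh
      exact ⟨Or.inr ((mem_R1_iff hp).2 ⟨_, _, R1Form.diagonal hp.pos h1⟩),
        Or.inr ((mem_R1_iff hp).2 ⟨_, _, colFactor_R1Form hp.pos h0 h2⟩),
        colFactor_productCond hp.pos h0 h1 h2⟩
    · obtain ⟨⟨h0, h1⟩, h2⟩ := mem_rowParams.1 hkh
      exact ⟨Or.inr ((mem_R1_iff hp).2 ⟨_, _, R1Form.diagonal hp.pos h0.symm⟩),
        Or.inr ((mem_R1_iff hp).2 ⟨_, _, rowFactor_R1Form hp.pos h1 h2⟩),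
        rowFactor_productCond hp.pos h0 h1 h2⟩
  · rintro ⟨hA | hA, hB | hB, hAB⟩
    · exact absurd hAB (not_productCond_R0_R0 hp hA hB)
    · obtain ⟨a, b, hB⟩ := (mem_R1_iff hp).1 hB
      obtain ⟨rfl, rfl⟩ := exp_of_R0_left hp hA hB hAB
      obtain ⟨f, g, hf, hg, hfg, rfl, rfl⟩ := eq_crossFactor_of_productCond hm hp hA hB hAB
      exact Or.inl ⟨(f, g), (mem_crossParams hp.pos).2 ⟨hf, hg, hfg⟩, rfl⟩
    · obtain ⟨a, b, hA⟩ := (mem_R1_iff hp).1 hA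
      exact absurd hAB (not_productCond_R1_R0 hp hA hB)
    · obtain ⟨a, b, hA⟩ := (mem_R1_iff hp).1 hA
      obtain ⟨a', b', hB⟩ := (mem_R1_iff hp).1 hB
      rcases exp_of_R1_R1 hp hA hB hAB with ⟨h0, h1, rfl, rfl, rfl⟩ | ⟨h0, h1, rfl, rfl, rfl⟩
      · obtain ⟨rfl, h, hh, rfl⟩ := eq_colFactor_of_productCond hp h0 h1 hA hB hAB
        exact Or.inr (Or.inl ⟨⟨_, h⟩, mem_colParams.2 ⟨⟨h0, h1⟩, hh⟩, rfl⟩)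
      · obtain ⟨rfl, h, hh, rfl⟩ := eq_rowFactor_of_productCond hp h0 h1 hA hB hAB
        exact Or.inr (Or.inr ⟨⟨_, h⟩, mem_rowParams.2 ⟨⟨h0, h1⟩, hh⟩, rfl⟩)

lemma upper_and_diag_pos {n p : ℕ} (hp : p.Prime) {C : Matrix (Fin n) (Fin n) ℤ}
    (hC : C ∈ R0 n p ∪ R1 n p) : (∀ i j, j < i → C i j = 0) ∧ ∀ i, 0 < C i i := by
  rcases hC with hC | hC
  · refine ⟨hC.1, fun i => ?_⟩
    rw [hC.2.2.2.1]
    exact_mod_cast hp.pos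
  · obtain ⟨a, b, h⟩ := (mem_R1_iff hp).1 hC
    exact ⟨h.upper, h.diag_pos hp.pos⟩

lemma toQ_mul_mem_iff_productCond {m p : ℕ} (hp : p.Prime)
    {A B : Matrix (Fin (m + 2)) (Fin (m + 2)) ℤ} (hA : A ∈ R0 (m + 2) p ∪ R1 (m + 2) p)
    (hB : B ∈ R0 (m + 2) p ∪ R1 (m + 2) p) :
    toQ (m + 2) (A * B) ∈ rightCoset (m + 2) (Matrix.diagonal fun i : Fin (m + 2) =>
      if i.val = 0 then (p : ℚ) else if i.val = m + 2 - 1 then (p : ℚ) ^ 3 else (p : ℚ) ^ 2) ↔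
      ProductCond p A B := by
  have hd : (fun i : Fin (m + 2) =>
      if i.val = 0 then (p : ℚ) else if i.val = m + 2 - 1 then (p : ℚ) ^ 3 else (p : ℚ) ^ 2) =
      fun i => (((p : ℤ) ^ targetExp i : ℤ) : ℚ) := by
    funext i
    have h1 : i.val = 0 ↔ i = 0 := by rw [Fin.ext_iff, Fin.val_zero]
    have h2 : i.val = m + 2 - 1 ↔ i = Fin.last (m + 1) := by rw [Fin.ext_iff, Fin.val_last]; rfl
    simp only [h1, h2, targetExp]
    split_ifs <;> simp
  have hp' : (0 : ℤ) < p := by exact_mod_cast hp.pos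
  obtain ⟨hA1, hA2⟩ := upper_and_diag_pos hp hA
  obtain ⟨hB1, hB2⟩ := upper_and_diag_pos hp hB
  rw [hd]
  exact toQ_mul_mem_rightCoset_iff (fun i => pow_pos hp' _) hA1 hB1 hA2 hB2

theorem statement15 (n p : ℕ) (hn : 4 ≤ n) (hp : p.Prime) :
    ({CC : Matrix (Fin n) (Fin n) ℤ × Matrix (Fin n) (Fin n) ℤ |
        CC.1 ∈ R0 n p ∪ R1 n p ∧ CC.2 ∈ R0 n p ∪ R1 n p ∧
        toQ n (CC.1 * CC.2) ∈ rightCoset n (Matrix.diagonal fun i : Fin n =>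
      if i.val = 0 then (p : ℚ) else if i.val = n - 1 then (p : ℚ) ^ 3 else (p : ℚ) ^ 2)}.ncard : ℚ) =
      (2 * (p : ℚ) ^ n - (p : ℚ) ^ 2 - 2 * (p : ℚ) + 1) / ((p : ℚ) - 1) := by
  obtain ⟨m, rfl⟩ : ∃ m, n = m + 2 := ⟨n - 2, by omega⟩
  have hset : {CC : Matrix (Fin (m + 2)) (Fin (m + 2)) ℤ × Matrix (Fin (m + 2)) (Fin (m + 2)) ℤ |
      CC.1 ∈ R0 (m + 2) p ∪ R1 (m + 2) p ∧ CC.2 ∈ R0 (m + 2) p ∪ R1 (m + 2) p ∧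
      toQ (m + 2) (CC.1 * CC.2) ∈ rightCoset (m + 2) (Matrix.diagonal fun i : Fin (m + 2) =>
        if i.val = 0 then (p : ℚ) else if i.val = m + 2 - 1 then (p : ℚ) ^ 3
          else (p : ℚ) ^ 2)} = (cosetPairs m p : Set _) := by
    ext ⟨A, B⟩
    rw [Finset.mem_coe, mem_cosetPairs_iff (by omega) hp]
    exact and_congr_right fun hA => and_congr_right fun hB => toQ_mul_mem_iff_productCond hp hA hB
  rw [hset, Set.ncard_coe_finset, card_cosetPairs hp]
  have h1 : (1 : ℚ) < p := by exact_mod_cast hp.one_lt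
  rw [eq_div_iff (by linarith)]
  have hgeom := mul_geom_sum (p : ℚ) m
  push_cast [Nat.one_le_pow _ _ hp.pos]
  simp only [pow_succ _ (_ : ℕ), ← Finset.sum_mul] at *
  linear_combination 2 * (p : ℚ) * hgeom
end

section
/- Let n ≥ 4 be an integer and p a prime. The number of ordered pairs (C, C') with C, C' ∈ R^(n)(p) = R₀^(n)(p) ∪ R₁^(n)(p) such that the product C·C' belongs to the right coset Λ_n·diag(p, p, p², …, p², p⁴) (with n−3 entries equal to p²) equals p + 1. -/
open Matrix

/-- The diagonal of an element of `R₁` whose entry `1` is at `o` and whose entry `p²` is last. -/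
def oneDiag (n p : ℕ) (o i : Fin n) : ℤ :=
  if i = o then 1 else if i.val = n - 1 then (p : ℤ) ^ 2 else p

/-- The matrix with diagonal `oneDiag n p o`, entry `t` at position `(0, 1)`, and zeros
elsewhere. -/
def oneMat (n p : ℕ) (o : Fin n) (t : ℤ) : Matrix (Fin n) (Fin n) ℤ :=
  Matrix.of fun i j => if i = j then oneDiag n p o i else
    if i.val = 0 ∧ j.val = 1 then t else 0

/-- The diagonal `(p, p, p², …, p², p⁴)`. -/
def targetDiag (n p : ℕ) (i : Fin n) : ℤ :=
  if i.val ≤ 1 then (p : ℤ) else if i.val = n - 1 then (p : ℤ) ^ 4 else (p : ℤ) ^ 2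

lemma toQ_mem_rightCoset_diagonal_iff {n : ℕ} {M : Matrix (Fin n) (Fin n) ℤ} {d : Fin n → ℤ}
    (hd : ∀ i, 0 < d i) (hM : ∀ i j, j < i → M i j = 0) (hpos : ∀ i, 0 < M i i) :
    toQ n M ∈ rightCoset n (Matrix.diagonal fun i => (d i : ℚ)) ↔
      (∀ i, M i i = d i) ∧ ∀ i j, d j ∣ M i j := by
  constructor
  · rintro ⟨γ, ⟨hint, hdet⟩, hγ⟩
    choose Z hZ using hint
    have hMZ : ∀ i j, M i j = Z i j * d j := by
      intro i j
      have h := congrFun (congrFun hγ i) j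
      rw [Matrix.mul_diagonal, hZ] at h
      simp only [toQ, Matrix.map_apply] at h
      exact_mod_cast h
    have htri : (Matrix.of Z).BlockTriangular id := by
      intro i j hij
      have h := hMZ i j
      rw [hM i j hij] at h
      exact (mul_eq_zero.1 h.symm).resolve_right (hd j).ne'
    have hγZ : γ = (Matrix.of Z).map (Int.castRingHom ℚ) := by
      ext i j
      simp [hZ]
    have hunit : IsUnit (∏ i, Z i i) := by
      have hprod := Matrix.det_of_isUpperTriangular htri
      simp only [Matrix.of_apply] at hprod
      rw [← hprod, Int.isUnit_iff]
      rw [hγZ, ← RingHom.mapMatrix_apply, ← RingHom.map_det] at hdet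
      rcases hdet with h | h
      · left; simp only [eq_intCast] at h; exact_mod_cast h
      · right; simp only [eq_intCast] at h; exact_mod_cast h
    refine ⟨fun i => ?_, fun i j => ⟨Z i j, by rw [hMZ, mul_comm]⟩⟩
    have hu : IsUnit (Z i i) :=
      isUnit_of_dvd_unit (Finset.dvd_prod_of_mem (fun k => Z k k) (Finset.mem_univ i)) hunit
    have h0 : 0 < Z i i := by
      have h := hpos i
      rw [hMZ] at h
      exact pos_of_mul_pos_left h (hd i).le
    rcases Int.isUnit_iff.1 hu with h | h
    · rw [hMZ, h, one_mul]
    · omega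
  · rintro ⟨hdiag, hdvd⟩
    choose Z hZ using hdvd
    have htri : (Matrix.of Z).BlockTriangular id := by
      intro i j hij
      have h := hZ i j
      rw [hM i j hij] at h
      exact (mul_eq_zero.1 h.symm).resolve_left (hd j).ne'
    have hone : ∀ i, Z i i = 1 := by
      intro i
      have h := hZ i i
      rw [hdiag] at h
      exact mul_left_cancel₀ (hd i).ne' (by rw [← h, mul_one])
    refine ⟨(Matrix.of Z).map (Int.castRingHom ℚ), ⟨fun i j => ⟨Z i j, by simp⟩, Or.inl ?_⟩, ?_⟩
    · rw [← RingHom.mapMatrix_apply, ← RingHom.map_det, Matrix.det_of_isUpperTriangular htri]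
      simp [hone]
    · ext i j
      simp [toQ, hZ i j, mul_comm]

section

variable {n p : ℕ} {o l : Fin n} {C C' : Matrix (Fin n) (Fin n) ℤ}

lemma diag_eq_oneDiag (hC : C ∈ R1 n p) (hl : l.val = n - 1)
    (ho : C o o = 1) (hCl : C l l = (p : ℤ) ^ 2) (i : Fin n) : C i i = oneDiag n p o i := by
  obtain ⟨-, hd, h1, h2, -, -⟩ := hC
  unfold oneDiag
  split_ifs with h h'
  · rw [h, ho]
  · rw [show i = l from Fin.ext (h'.trans hl.symm), hCl]
  · rcases hd i with hi | hi | hi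
    · exact absurd (h1.unique hi ho) h
    · exact hi
    · exact absurd (congrArg Fin.val (h2.unique hi hCl)) (by omega)

/-- Away from the row of the entry `1` and from the last column, an element of `R₁` with last
diagonal entry `p²` is diagonal. -/
lemma R1_apply_eq_zero (hC : C ∈ R1 n p) (hl : l.val = n - 1)
    (hdiag : ∀ i, C i i = oneDiag n p o i) {i j : Fin n} (hi : i ≠ o) (hij : i ≠ j)
    (hj : j ≠ l) (hp : p.Prime) : C i j = 0 := by
  obtain ⟨ht, -, -, -, hb, hdv⟩ := hC
  have hp1 : (1 : ℤ) < p := by exact_mod_cast hp.one_lt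
  rcases lt_or_gt_of_ne hij with h | h
  · have hpd : (p : ℤ) ∣ C i i := by
      rw [hdiag, oneDiag, if_neg hi]
      split_ifs
      · exact dvd_pow_self _ two_ne_zero
      · exact dvd_rfl
    have hj' : j.val ≠ n - 1 := fun h => hj (Fin.ext (h.trans hl.symm))
    have hlt : C j j ≤ p := by
      rw [hdiag, oneDiag, if_neg hj']
      split_ifs <;> omega
    obtain ⟨h0, h1⟩ := hb i j h
    exact Int.eq_zero_of_dvd_of_nonneg_of_lt h0 (h1.trans_le hlt) (hdv i j h hpd)
  · exact ht i j h

lemma last_column_eq_zero {P a x y : ℤ} (hP : 1 < P) (hx : 0 ≤ x) (hx' : x < P ^ 2)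
    (hy : 0 ≤ y) (hy' : y < P ^ 2) (ha : a = 1 ∨ a = P ∧ P ∣ y)
    (h : P ^ 4 ∣ a * x + y * P ^ 2) : x = 0 ∧ y = 0 := by
  have hP0 : P ≠ 0 := by omega
  have hx0 : x = 0 := by
    refine Int.eq_zero_of_dvd_of_nonneg_of_lt hx hx' ?_
    rcases ha with rfl | ⟨rfl, z, rfl⟩
    · obtain ⟨w, hw⟩ := h
      exact ⟨P ^ 2 * w - y, by linear_combination hw⟩
    · obtain ⟨w, hw⟩ := h
      refine ⟨a * w - z, mul_left_cancel₀ hP0 ?_⟩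
      linear_combination hw
  refine ⟨hx0, Int.eq_zero_of_dvd_of_nonneg_of_lt hy hy' ?_⟩
  obtain ⟨w, hw⟩ := h
  refine ⟨w, mul_right_cancel₀ (pow_ne_zero 2 hP0) ?_⟩
  rw [hx0] at hw
  linear_combination hw

/-- The factors are diagonal, up to the entry `(0, 1)` of the second one. -/
lemma eq_oneMat_of_dvd {e₀ e₁ o' : Fin n} (hn : 4 ≤ n) (hp : p.Prime) (hC : C ∈ R1 n p)
    (hC' : C' ∈ R1 n p) (h₀ : e₀.val = 0) (h₁ : e₁.val = 1) (hl : l.val = n - 1)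
    (hoo : o = e₀ ∧ o' = e₁ ∨ o = e₁ ∧ o' = e₀)
    (hdiag : ∀ i, C i i = oneDiag n p o i) (hdiag' : ∀ i, C' i i = oneDiag n p o' i)
    (hdvd : ∀ i j, targetDiag n p j ∣ (C * C') i j) :
    C = oneMat n p o 0 ∧ C' = oneMat n p o' (C' e₀ e₁) := by
  have hp1 : (1 : ℤ) < p := by exact_mod_cast hp.one_lt
  have hp0 : (p : ℤ) ≠ 0 := by omega
  have ho1 : o.val ≤ 1 := by rcases hoo with ⟨h, -⟩ | ⟨h, -⟩ <;> subst h <;> omega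
  have ho1' : o'.val ≤ 1 := by rcases hoo with ⟨-, h⟩ | ⟨-, h⟩ <;> subst h <;> omega
  have hne : o ≠ o' := by
    rintro rfl
    rcases hoo with ⟨h, h'⟩ | ⟨h, h'⟩ <;> subst h <;> simp_all
  have z : ∀ {i j : Fin n}, i ≠ o → i ≠ j → j ≠ l → C i j = 0 := fun hi hij hj =>
    R1_apply_eq_zero hC hl hdiag hi hij hj hp
  have z' : ∀ {i j : Fin n}, i ≠ o' → i ≠ j → j ≠ l → C' i j = 0 := fun hi hij hj =>
    R1_apply_eq_zero hC' hl hdiag' hi hij hj hp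
  obtain ⟨ht, -, -, -, hb, hdv⟩ := hC
  obtain ⟨ht', -, -, -, hb', -⟩ := hC'
  have lval : ∀ {j : Fin n}, j ≠ l → j.val < n - 1 := by
    intro j hj
    have : j.val ≠ n - 1 := fun h => hj (Fin.ext (h.trans hl.symm))
    omega
  have llast : ∀ {j : Fin n}, j ≠ l → C' l j = 0 := fun hj => ht' _ _ (by
    have := lval hj
    rw [Fin.lt_def]; omega)
  have hmid : ∀ {j : Fin n}, 2 ≤ j.val → j ≠ l →
      C j j = p ∧ C' j j = p ∧ targetDiag n p j = (p : ℤ) ^ 2 := by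
    intro j hj hjl
    have h1 : j ≠ o := by rintro rfl; omega
    have h2 : j ≠ o' := by rintro rfl; omega
    have h3 := lval hjl
    rw [hdiag, hdiag', oneDiag, oneDiag, targetDiag, if_neg h1, if_neg h2, if_neg h3.ne,
      if_neg (by omega), if_neg h3.ne]
    exact ⟨rfl, rfl, rfl⟩
  have hol : o ≠ l := by rintro rfl; omega
  have hol' : o' ≠ l := by rintro rfl; omega
  have hmid' : ∀ {j : Fin n}, 2 ≤ j.val → j ≠ l → C' o' j = 0 := by
    intro j hj hjl
    have hlt : o' < j := by rw [Fin.lt_def]; omega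
    obtain ⟨hc, hc', ht⟩ := hmid hj hjl
    obtain ⟨hb0, hb1⟩ := hb' o' j hlt
    have hd := hdvd o' j
    rw [Matrix.mul_apply, Fintype.sum_eq_single o', hdiag, oneDiag, if_neg hne.symm,
      if_neg (lval hol').ne, ht, pow_two] at hd
    · exact Int.eq_zero_of_dvd_of_nonneg_of_lt hb0 (hc' ▸ hb1)
        (Int.dvd_of_mul_dvd_mul_left hp0 hd)
    · intro k hk
      by_cases hkl : k = l
      · rw [hkl, llast hjl, mul_zero]
      · rw [z hne.symm hk.symm hkl, zero_mul]
  have hrow : ∀ {j : Fin n}, 2 ≤ j.val → j ≠ l → C o j = 0 := by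
    intro j hj hjl
    have hlt : o < j := by rw [Fin.lt_def]; omega
    obtain ⟨hc, hc', ht⟩ := hmid hj hjl
    obtain ⟨hb0, hb1⟩ := hb o j hlt
    have hd := hdvd o j
    rw [Matrix.mul_apply, Fintype.sum_eq_single j, hc', ht, pow_two] at hd
    · exact Int.eq_zero_of_dvd_of_nonneg_of_lt hb0 (hc ▸ hb1)
        (Int.dvd_of_mul_dvd_mul_right hp0 hd)
    · intro k hk
      by_cases hko : k = o'
      · rw [hko, hmid' hj hjl, mul_zero]
      · rw [z' hko hk hjl, mul_zero]
  have h1l : e₁ ≠ l := by rintro rfl; omega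
  have h01 : e₀ ≠ e₁ := by rintro rfl; omega
  have h01lt : e₀ < e₁ := by rw [Fin.lt_def]; omega
  have hC01 : C e₀ e₁ = 0 := by
    rcases hoo with ⟨rfl, rfl⟩ | ⟨rfl, rfl⟩
    · obtain ⟨hb0, hb1⟩ := hb o o' h01lt
      have hd := hdvd o o'
      rw [Matrix.mul_apply, Fintype.sum_eq_single o', hdiag' o', oneDiag, if_pos rfl, mul_one,
        targetDiag, if_pos ho1'] at hd
      · rw [hdiag, oneDiag, if_neg hne.symm, if_neg (lval h1l).ne] at hb1
        exact Int.eq_zero_of_dvd_of_nonneg_of_lt hb0 hb1 hd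
      · intro k hk
        rw [z' hk hk h1l, mul_zero]
    · exact z hne.symm h01 h1l
  have hoff : ∀ {i j : Fin n}, i ≠ j → j ≠ l → C i j = 0 := by
    intro i j hij hjl
    by_cases hi : i = o
    · subst hi
      by_cases hj : 2 ≤ j.val
      · exact hrow hj hjl
      · rcases lt_or_gt_of_ne hij with h | h
        · rw [Fin.lt_def] at h
          have e1 : i = e₀ := Fin.ext (by omega)
          have e2 : j = e₁ := Fin.ext (by omega)
          rw [e1, e2, hC01]
        · exact ht _ _ h
    · exact z hi hij hjl
  have hll : l ≠ o := hol.symm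
  have hlast : ∀ {i : Fin n}, i ≠ l → C' i l = 0 ∧ C i l = 0 := by
    intro i hil
    have hlt : i < l := by
      have := lval hil
      rw [Fin.lt_def]; omega
    obtain ⟨hb0, hb1⟩ := hb i l hlt
    obtain ⟨hb0', hb1'⟩ := hb' i l hlt
    have hd := hdvd i l
    have e : C l l = (p : ℤ) ^ 2 := by rw [hdiag, oneDiag, if_neg hol.symm, if_pos hl]
    have e' : C' l l = (p : ℤ) ^ 2 := by rw [hdiag', oneDiag, if_neg hol'.symm, if_pos hl]
    rw [Matrix.mul_apply, Fintype.sum_eq_add i l hil, e', targetDiag, if_neg (by omega),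
      if_pos hl] at hd
    · refine last_column_eq_zero hp1 hb0' (e' ▸ hb1') hb0 (e ▸ hb1) ?_ hd
      by_cases hi : i = o
      · left; rw [hdiag, oneDiag, if_pos hi]
      · have hii : C i i = p := by rw [hdiag, oneDiag, if_neg hi, if_neg (lval hil).ne]
        exact Or.inr ⟨hii, hdv i l hlt (by rw [hii])⟩
    · rintro k ⟨hk, hkl⟩
      rw [hoff hk.symm hkl, zero_mul]
  constructor
  · ext i j
    simp only [oneMat, Matrix.of_apply, ite_self]
    split_ifs with hij
    · rw [← hij, hdiag]
    · by_cases hj : j = l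
      · subst hj; exact (hlast hij).2
      · exact hoff hij hj
  · ext i j
    simp only [oneMat, Matrix.of_apply]
    split_ifs with hij h
    · rw [← hij, hdiag']
    · rw [show i = e₀ from Fin.ext (by omega), show j = e₁ from Fin.ext (by omega)]
    · by_cases hj : j = l
      · subst hj; exact (hlast hij).1
      · by_cases hi : i = o'
        · subst hi
          by_cases hj2 : 2 ≤ j.val
          · exact hmid' hj2 hj
          · rcases lt_or_gt_of_ne hij with h | h
            · rw [Fin.lt_def] at h
              omega
            · exact ht' _ _ h
        · exact z' hi hij hj

lemma oneMat_mem_R1 (hn : 4 ≤ n) (hp : p.Prime) (ho : o.val ≤ 1) {t : ℤ}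
    (ht : t = 0 ∨ o.val = 0 ∧ 0 ≤ t ∧ t < p) : oneMat n p o t ∈ R1 n p := by
  have hp1 : (1 : ℤ) < p := by exact_mod_cast hp.one_lt
  have hpp : (p : ℤ) < (p : ℤ) ^ 2 := by nlinarith
  have hdiag : ∀ i, oneMat n p o t i i = oneDiag n p o i := by simp [oneMat]
  have hpos : ∀ i, 0 < oneDiag n p o i := by
    intro i; unfold oneDiag; split_ifs <;> omega
  refine ⟨fun i j hij => ?_, fun i => ?_, ⟨o, ?_, fun i hi => ?_⟩,
    ⟨⟨n - 1, by omega⟩, ?_, fun i hi => ?_⟩, fun i j hij => ?_, fun i j hij hd => ?_⟩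
  · rw [Fin.lt_def] at hij
    simp only [oneMat, Matrix.of_apply]
    rw [if_neg (by rintro rfl; omega), if_neg (by omega)]
  · rw [hdiag]; unfold oneDiag; split_ifs <;> simp
  · simp [hdiag, oneDiag]
  · simp only [hdiag, oneDiag] at hi
    split_ifs at hi with h
    · exact h
    · omega
    · omega
  · simp only [hdiag, oneDiag]
    rw [if_neg fun h => ?_, if_pos trivial]
    rw [← h] at ho
    simp only at ho
    omega
  · simp only [hdiag, oneDiag] at hi
    split_ifs at hi with h h'
    · omega
    · exact Fin.ext h'
    · omega
  · rw [hdiag]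
    have := hpos j
    simp only [oneMat, Matrix.of_apply, if_neg hij.ne]
    split_ifs with h
    · rcases ht with rfl | ⟨h0, h1, h2⟩
      · exact ⟨le_rfl, this⟩
      · refine ⟨h1, ?_⟩
        rw [oneDiag, if_neg (by rintro rfl; omega), if_neg (by omega)]
        exact h2
    · exact ⟨le_rfl, this⟩
  · rw [hdiag] at hd
    simp only [oneMat, Matrix.of_apply, if_neg hij.ne]
    split_ifs with h
    · rcases ht with rfl | ⟨h0, h1, h2⟩
      · exact dvd_zero _
      · rw [oneDiag, if_pos (Fin.ext (by omega))] at hd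
        exact absurd (Int.le_of_dvd one_pos hd) (by omega)
    · exact dvd_zero _

lemma oneMat_zero_eq_diagonal : oneMat n p o 0 = Matrix.diagonal (oneDiag n p o) := by
  ext i j
  simp [oneMat, Matrix.diagonal_apply]

lemma upper_of_mem (hC : C ∈ R0 n p ∪ R1 n p) {i j : Fin n} (h : j < i) : C i j = 0 := by
  rcases hC with hC | hC
  exacts [hC.1 i j h, hC.1 i j h]

lemma diag_of_mem (hC : C ∈ R0 n p ∪ R1 n p) (i : Fin n) :
    C i i = 1 ∨ C i i = (p : ℤ) ∨ C i i = (p : ℤ) ^ 2 := by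
  rcases hC with hC | hC
  exacts [Or.inr (Or.inl (hC.2.2.2.1 i)), hC.2.1 i]

lemma mem_R1_of_diag_eq_sq (hp : p.Prime) (hC : C ∈ R0 n p ∪ R1 n p)
    (h : C l l = (p : ℤ) ^ 2) : C ∈ R1 n p := by
  rcases hC with hC | hC
  · have hp1 : (1 : ℤ) < p := by exact_mod_cast hp.one_lt
    have h' := hC.2.2.2.1 l
    nlinarith
  · exact hC

lemma mul_apply_of_upper (hC : ∀ i j, j < i → C i j = 0) (hC' : ∀ i j, j < i → C' i j = 0) :
    (∀ i j, j < i → (C * C') i j = 0) ∧ ∀ i, (C * C') i i = C i i * C' i i := by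
  constructor
  · exact fun i j hij => Matrix.BlockTriangular.mul (b := id) (M := C) (N := C')
      (fun i j h => hC i j h) (fun i j h => hC' i j h) hij
  · intro i
    rw [Matrix.mul_apply, Fintype.sum_eq_single i]
    intro k hk
    rcases lt_or_gt_of_ne hk with h | h
    · rw [hC i k h, zero_mul]
    · rw [hC' k i h, mul_zero]

lemma toQ_mul_mem_iff (hp : p.Prime) (hC : C ∈ R0 n p ∪ R1 n p) (hC' : C' ∈ R0 n p ∪ R1 n p) :
    toQ n (C * C') ∈ rightCoset n (Matrix.diagonal fun i : Fin n =>
      if i.val ≤ 1 then (p : ℚ) else if i.val = n - 1 then (p : ℚ) ^ 4 else (p : ℚ) ^ 2) ↔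
      (∀ i, C i i * C' i i = targetDiag n p i) ∧ ∀ i j, targetDiag n p j ∣ (C * C') i j := by
  have hp0 : (0 : ℤ) < p := by exact_mod_cast hp.pos
  obtain ⟨h1, h2⟩ := mul_apply_of_upper (fun i j h => upper_of_mem hC h)
    (fun i j h => upper_of_mem hC' h)
  have hpos : ∀ {M}, M ∈ R0 n p ∪ R1 n p → ∀ i, 0 < M i i := by
    intro M hM i
    rcases diag_of_mem hM i with h | h | h <;> rw [h] <;> positivity
  have key := toQ_mem_rightCoset_diagonal_iff (M := C * C') (d := targetDiag n p)
    (fun i => by unfold targetDiag; split_ifs <;> positivity) h1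
    (fun i => by rw [h2]; exact mul_pos (hpos hC i) (hpos hC' i))
  simp only [h2] at key
  rw [← key]
  have hfun : (fun i : Fin n => ((targetDiag n p i : ℤ) : ℚ)) = fun i : Fin n =>
      if i.val ≤ 1 then (p : ℚ) else if i.val = n - 1 then (p : ℚ) ^ 4 else (p : ℚ) ^ 2 := by
    funext i
    unfold targetDiag
    split_ifs <;> push_cast <;> rfl
  rw [hfun]

lemma sq_of_mul_eq_pow_four {P a b : ℤ} (hP : 1 < P) (ha : a = 1 ∨ a = P ∨ a = P ^ 2)
    (hb : b = 1 ∨ b = P ∨ b = P ^ 2) (h : a * b = P ^ 4) : a = P ^ 2 ∧ b = P ^ 2 := by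
  have h1 : P < P ^ 2 := by nlinarith
  have h2 : P ^ 2 < P ^ 3 := by nlinarith
  have h3 : P ^ 3 < P ^ 4 := by nlinarith
  rcases ha with rfl | rfl | rfl <;> rcases hb with rfl | rfl | rfl <;> ring_nf at h <;>
    first | exact ⟨rfl, rfl⟩ | (exfalso; linarith)

lemma one_of_mul_eq {P a b : ℤ} (hP : 1 < P) (ha : a = 1 ∨ a = P ∨ a = P ^ 2)
    (hb : b = 1 ∨ b = P ∨ b = P ^ 2) (h : a * b = P) : a = 1 ∧ b = P ∨ a = P ∧ b = 1 := by
  have h1 : P < P ^ 2 := by nlinarith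
  have h2 : P ^ 2 < P ^ 3 := by nlinarith
  have h3 : P ^ 3 < P ^ 4 := by nlinarith
  rcases ha with rfl | rfl | rfl <;> rcases hb with rfl | rfl | rfl <;> ring_nf at h <;>
    first | exact Or.inl ⟨rfl, rfl⟩ | exact Or.inr ⟨rfl, rfl⟩ | (exfalso; linarith)

lemma oneMat_mul_conditions {e₀ e₁ o' : Fin n} (hn : 4 ≤ n) (h₀ : e₀.val = 0)
    (h₁ : e₁.val = 1) {t : ℤ} (hoo : o = e₀ ∧ o' = e₁ ∧ t = 0 ∨ o = e₁ ∧ o' = e₀) :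
    (∀ i, oneMat n p o 0 i i * oneMat n p o' t i i = targetDiag n p i) ∧
      ∀ i j, targetDiag n p j ∣ (oneMat n p o 0 * oneMat n p o' t) i j := by
  have hdiag : ∀ i, oneMat n p o 0 i i * oneMat n p o' t i i = targetDiag n p i := by
    intro i
    simp only [oneMat, Matrix.of_apply, if_true, oneDiag, targetDiag]
    have e0 : i = e₀ ↔ i.val = 0 := by rw [Fin.ext_iff, h₀]
    have e1 : i = e₁ ↔ i.val = 1 := by rw [Fin.ext_iff, h₁]
    rcases hoo with ⟨rfl, rfl, -⟩ | ⟨rfl, rfl⟩ <;> simp only [e0, e1] <;> split_ifs <;>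
      first | omega | ring
  refine ⟨hdiag, fun i j => ?_⟩
  rw [oneMat_zero_eq_diagonal, Matrix.diagonal_mul]
  by_cases hij : i = j
  · subst hij
    rw [← hdiag]
    simp [oneMat]
  · simp only [oneMat, Matrix.of_apply, if_neg hij]
    split_ifs with h
    · rcases hoo with ⟨-, -, rfl⟩ | ⟨rfl, rfl⟩
      · simp
      · rw [oneDiag, if_neg (fun h' => by rw [← h'] at h₁; omega), if_neg (by omega),
          targetDiag, if_pos (by omega)]
        exact dvd_mul_right _ _
    · simp

end

theorem statement18 (n p : ℕ) (hn : 4 ≤ n) (hp : p.Prime) :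
    {CC : Matrix (Fin n) (Fin n) ℤ × Matrix (Fin n) (Fin n) ℤ |
        CC.1 ∈ R0 n p ∪ R1 n p ∧ CC.2 ∈ R0 n p ∪ R1 n p ∧
        toQ n (CC.1 * CC.2) ∈ rightCoset n (Matrix.diagonal fun i : Fin n =>
      if i.val ≤ 1 then (p : ℚ) else if i.val = n - 1 then (p : ℚ) ^ 4 else (p : ℚ) ^ 2)}.ncard =
      p + 1 := by
  set e₀ : Fin n := ⟨0, by omega⟩
  set e₁ : Fin n := ⟨1, by omega⟩
  set l : Fin n := ⟨n - 1, by omega⟩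
  have hp1 : (1 : ℤ) < p := by exact_mod_cast hp.one_lt
  have h01 : e₀ ≠ e₁ := by simp [e₀, e₁]
  have h01lt : e₀ < e₁ := by simp [e₀, e₁]
  let f : ℕ → Matrix (Fin n) (Fin n) ℤ × Matrix (Fin n) (Fin n) ℤ :=
    fun t => (oneMat n p e₁ 0, oneMat n p e₀ t)
  have hf : Function.Injective f := by
    intro s t hst
    have h := congrFun (congrFun (congrArg Prod.snd hst) e₀) e₁
    simpa [f, oneMat, h01, e₀, e₁] using h
  have hnot : (oneMat n p e₀ 0, oneMat n p e₁ 0) ∉ f '' (Finset.range p : Set ℕ) := by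
    rintro ⟨t, -, ht⟩
    have h := congrFun (congrFun (congrArg Prod.fst ht) e₀) e₀
    have hl : (0 : ℕ) ≠ n - 1 := by omega
    simp [f, oneMat, oneDiag, e₀, e₁, hl] at h
    omega
  suffices hset : {CC : Matrix (Fin n) (Fin n) ℤ × Matrix (Fin n) (Fin n) ℤ |
        CC.1 ∈ R0 n p ∪ R1 n p ∧ CC.2 ∈ R0 n p ∪ R1 n p ∧
        toQ n (CC.1 * CC.2) ∈ rightCoset n (Matrix.diagonal fun i : Fin n =>
      if i.val ≤ 1 then (p : ℚ) else if i.val = n - 1 then (p : ℚ) ^ 4 else (p : ℚ) ^ 2)} =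
      insert (oneMat n p e₀ 0, oneMat n p e₁ 0) (f '' (Finset.range p : Set ℕ)) by
    rw [hset, Set.ncard_insert_of_notMem hnot ((Finset.finite_toSet _).image _),
      Set.ncard_image_of_injective _ hf, Set.ncard_coe_finset, Finset.card_range]
  ext ⟨C, C'⟩
  simp only [Set.mem_ofPred_eq, Set.mem_insert_iff, Set.mem_image, Finset.coe_range, Set.mem_Iio,
    Prod.mk.injEq, f]
  constructor
  · rintro ⟨hC, hC', hmem⟩
    obtain ⟨hd, hdvd⟩ := (toQ_mul_mem_iff hp hC hC').1 hmem
    obtain ⟨hl, hl'⟩ := sq_of_mul_eq_pow_four hp1 (diag_of_mem hC l) (diag_of_mem hC' l)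
      ((hd l).trans (by rw [targetDiag, if_neg (by simp only [l]; omega), if_pos rfl]))
    have h0 := one_of_mul_eq hp1 (diag_of_mem hC e₀) (diag_of_mem hC' e₀)
      ((hd e₀).trans (if_pos (by simp [e₀])))
    have h1 := one_of_mul_eq hp1 (diag_of_mem hC e₁) (diag_of_mem hC' e₁)
      ((hd e₁).trans (if_pos (by simp [e₁])))
    have hR := mem_R1_of_diag_eq_sq hp hC hl
    have hR' := mem_R1_of_diag_eq_sq hp hC' hl'
    rcases h0 with ⟨h0, h0'⟩ | ⟨h0, h0'⟩ <;> rcases h1 with ⟨h1, h1'⟩ | ⟨h1, h1'⟩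
    · exact absurd (hR.2.2.1.unique h0 h1) h01
    · obtain ⟨hE, hE'⟩ := eq_oneMat_of_dvd hn hp hR hR' (e₀ := e₀) (e₁ := e₁) (l := l) rfl rfl rfl
        (Or.inl ⟨rfl, rfl⟩) (diag_eq_oneDiag hR rfl h0 hl)
        (diag_eq_oneDiag hR' rfl h1' hl') hdvd
      have hz : C' e₀ e₁ = 0 := by
        have h := hR'.2.2.2.2.1 e₀ e₁ h01lt
        omega
      rw [hz] at hE'
      exact Or.inl ⟨hE, hE'⟩
    · obtain ⟨hE, hE'⟩ := eq_oneMat_of_dvd hn hp hR hR' (e₀ := e₀) (e₁ := e₁) (l := l) rfl rfl rfl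
        (Or.inr ⟨rfl, rfl⟩) (diag_eq_oneDiag hR rfl h1 hl)
        (diag_eq_oneDiag hR' rfl h0' hl') hdvd
      obtain ⟨hb0, hb1⟩ := hR'.2.2.2.2.1 e₀ e₁ h01lt
      refine Or.inr ⟨(C' e₀ e₁).toNat, by omega, hE.symm, ?_⟩
      rw [Int.toNat_of_nonneg hb0]
      exact hE'.symm
    · exact absurd (hR'.2.2.1.unique h0' h1') h01
  · rintro (⟨rfl, rfl⟩ | ⟨t, ht, rfl, rfl⟩)
    · have hA := Set.mem_union_right (R0 n p)
        (oneMat_mem_R1 hn hp (o := e₀) (by simp [e₀]) (Or.inl rfl))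
      have hB := Set.mem_union_right (R0 n p)
        (oneMat_mem_R1 hn hp (o := e₁) (by simp [e₁]) (Or.inl rfl))
      exact ⟨hA, hB, (toQ_mul_mem_iff hp hA hB).2
        (oneMat_mul_conditions hn rfl rfl (Or.inl ⟨rfl, rfl, rfl⟩))⟩
    · have hA := Set.mem_union_right (R0 n p)
        (oneMat_mem_R1 hn hp (o := e₁) (by simp [e₁]) (Or.inl rfl))
      have hB := Set.mem_union_right (R0 n p)
        (oneMat_mem_R1 hn hp (o := e₀) (t := t) (by simp [e₀])
          (Or.inr ⟨rfl, by positivity, by exact_mod_cast ht⟩))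
      exact ⟨hA, hB, (toQ_mul_mem_iff hp hA hB).2
        (oneMat_mul_conditions hn (e₀ := e₀) (e₁ := e₁) rfl rfl (Or.inr ⟨rfl, rfl⟩))⟩
end
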